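/- arXiv:math/9702232 — 3 statements merged into one kernel-verified Lean document; each statement's English description precedes it below -/
import Mathlib

section
/- Let Q ⊆ E with E quasireal, and let L, S be subfields of E containing Q, where L is a repeated radical extension of Q and S is a finite Galois extension of Q. Then L ∩ S is a repeated quadratic extension of Q (there is a tower of degree-2 extensions from Q up to L ∩ S). -/
/-- A field is quasireal if it has characteristic zero and its only roots of
unity are `±1`. -/
def IsQuasireal (L : Type*) [Field L] : Prop :=
  CharZero L ∧ ∀ ζ : L, (∃ n : ℕ, 0 < n ∧ ζ ^ n = 1) → ζ = 1 ∨ ζ = -1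

/-- `B = A[α]` for some `α` with a positive power of `α` in `A`
(a single radical step, inside a fixed ambient extension `E` of `Q`). -/
def RadicalStep (Q E : Type*) [Field Q] [Field E] [Algebra Q E]
    (A B : IntermediateField Q E) : Prop :=
  ∃ α : E, (∃ n : ℕ, 0 < n ∧ α ^ n ∈ A) ∧ B = A ⊔ IntermediateField.adjoin Q {α}

/-- `B` is obtained from `A` by a finite tower of radical extensions. -/
def IsRepeatedRadical (Q E : Type*) [Field Q] [Field E] [Algebra Q E]
    (A B : IntermediateField Q E) : Prop :=
  Relation.ReflTransGen (RadicalStep Q E) A B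

open Polynomial IntermediateField in
theorem aux_prime {A E : Type*} [Field A] [Field E] [Algebra A E] (hE : IsQuasireal E)
    {p : ℕ} (hp : p.Prime) {α θ : E} {a : A} (ha : α ^ p = algebraMap A E a)
    (hθ : θ ∈ A⟮α⟯) (hs : ((minpoly A θ).map (algebraMap A E)).Splits) :
    (minpoly A θ).natDegree = 1 ∨ (minpoly A θ).natDegree = 2 := by
  have : CharZero E := hE.1
  have : CharZero A := (algebraMap A E).charZero
  have hαi : IsIntegral A α := by
    apply IsIntegral.of_pow hp.pos
    rw [ha]; exact isIntegral_algebraMap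
  have : FiniteDimensional A A⟮α⟯ := adjoin.finiteDimensional hαi
  have hθi : IsIntegral A θ := by
    have := (IsIntegral.of_finite A (⟨θ, hθ⟩ : A⟮α⟯)).map A⟮α⟯.val
    simpa using this
  by_cases hb : ∃ b : A, b ^ p = a
  · left
    obtain ⟨b, rfl⟩ := hb
    have hα : α ∈ (⊥ : IntermediateField A E) := by
      rw [IntermediateField.mem_bot]
      by_cases hb0 : algebraMap A E b = 0
      · have : α ^ p = 0 := by rw [ha, map_pow, hb0, zero_pow hp.ne_zero]
        exact ⟨0, by rw [map_zero, eq_zero_of_pow_eq_zero this]⟩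
      · have : (α / algebraMap A E b) ^ p = 1 := by
          rw [div_pow, ha, map_pow, div_self (pow_ne_zero _ hb0)]
        rcases hE.2 _ ⟨p, hp.pos, this⟩ with h | h
        · exact ⟨b, by field_simp at h; exact h.symm⟩
        · exact ⟨-b, by field_simp at h; rw [h, map_neg]⟩
    have h2 : θ ∈ (⊥ : IntermediateField A E) := by
      have : A⟮α⟯ ≤ ⊥ := by
        rw [adjoin_simple_le_iff]; exact hα
      exact this hθ
    rw [IntermediateField.mem_bot] at h2
    exact minpoly.natDegree_eq_one_iff.mpr h2
  · push Not at hb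
    have hirr := X_pow_sub_C_irreducible_of_prime hp hb
    have hmin : minpoly A α = X ^ p - C a := by
      refine (minpoly.eq_of_irreducible_of_monic hirr ?_ (monic_X_pow_sub_C a hp.ne_zero)).symm
      simp [ha]
    have hfr : Module.finrank A A⟮α⟯ = p := by
      rw [adjoin.finrank hαi, hmin, natDegree_X_pow_sub_C]
    have hle : A⟮θ⟯ ≤ A⟮α⟯ := by rw [adjoin_simple_le_iff]; exact hθ
    have hdvd : (minpoly A θ).natDegree ∣ p := by
      rw [← adjoin.finrank hθi, ← hfr]
      exact finrank_dvd_of_le_right hle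
    rcases (Nat.dvd_prime hp).mp hdvd with h | h
    · exact Or.inl h
    · right
      have heq : A⟮θ⟯ = A⟮α⟯ := eq_of_le_of_finrank_eq hle (by
        rw [adjoin.finrank hθi, hfr, h])
      have hα : α ∈ A⟮θ⟯ := heq ▸ mem_adjoin_simple_self A α
      have hsα : ((minpoly A α).map (algebraMap A E)).Splits := by
        refine splits_of_mem_adjoin A E (S := {θ}) ?_ hα
        rintro x rfl
        exact ⟨hθi, hs⟩
      have hc := card_rootSet_eq_natDegree (K := E) (minpoly.irreducible hαi).separable hsα
      rw [hmin, natDegree_X_pow_sub_C] at hc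
      have hα0 : α ≠ 0 := by
        rintro rfl
        apply hb 0
        rw [zero_pow hp.ne_zero] at ha ⊢
        exact (algebraMap A E).injective (by rw [← ha, map_zero])
      have hsub : ((X ^ p - C a : A[X]).rootSet E) ⊆ {α, -α} := by
        intro x hx
        have hx' := (mem_rootSet.mp hx).2
        have hx2 : x ^ p = α ^ p := by
          rw [ha]; simpa [sub_eq_zero] using hx'
        have : (x / α) ^ p = 1 := by
          rw [div_pow, hx2, div_self (pow_ne_zero _ hα0)]
        rcases hE.2 _ ⟨p, hp.pos, this⟩ with h | h
        · left; field_simp at h; exact h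
        · right; field_simp at h; simpa using h
      have h3 := Set.ncard_le_ncard hsub (Set.toFinite _)
      have h4 := Set.ncard_insert_le α {-α}
      rw [Set.ncard_singleton] at h4
      rw [← Nat.card_coe_set_eq, Nat.card_eq_fintype_card, hc] at h3
      have := hp.two_le
      omega

open Polynomial IntermediateField in
theorem aux_coeff {Q E : Type*} [Field Q] [Field E] [Algebra Q E]
    (A S : IntermediateField Q E) [Normal Q S] {θ : E} (hθ : θ ∈ S) :
    ((minpoly A θ).map (algebraMap A E)).Splits ∧
    (minpoly (A ⊓ S : IntermediateField Q E) θ).natDegree = (minpoly A θ).natDegree := by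
  have hiS : IsIntegral Q (⟨θ, hθ⟩ : S) := Normal.isIntegral inferInstance _
  have hi : IsIntegral Q θ := by simpa using hiS.map S.val
  have hQS : ((minpoly Q θ).map (algebraMap Q S)).Splits := by
    have := Normal.splits (F := Q) (K := S) inferInstance ⟨θ, hθ⟩
    rwa [← minpoly.algebraMap_eq (algebraMap S E).injective] at this
  have hQE : ((minpoly Q θ).map (algebraMap Q E)).Splits := by
    have := hQS.map (algebraMap S E)
    rwa [Polynomial.map_map, ← IsScalarTower.algebraMap_eq] at this
  have hdvd : (minpoly A θ).map (algebraMap A E) ∣ (minpoly Q θ).map (algebraMap Q E) := by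
    have := Polynomial.map_dvd (algebraMap A E) (minpoly.dvd_map_of_isScalarTower Q A θ)
    rwa [Polynomial.map_map, ← IsScalarTower.algebraMap_eq] at this
  have hne : (minpoly Q θ).map (algebraMap Q E) ≠ 0 :=
    Polynomial.map_ne_zero (minpoly.ne_zero hi)
  have hsp : ((minpoly A θ).map (algebraMap A E)).Splits := hQE.of_dvd hne hdvd
  refine ⟨hsp, ?_⟩
  have hiA : IsIntegral A θ := hi.tower_top
  have hmon := minpoly.monic hiA
  have hroots : ∀ x ∈ ((minpoly A θ).map (algebraMap A E)).roots, x ∈ (algebraMap S E).range := by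
    intro x hx
    have hx1 : x ∈ ((minpoly Q θ).map (algebraMap Q E)).roots :=
      Multiset.mem_of_le (roots.le_of_dvd hne hdvd) hx
    have : (minpoly Q θ).map (algebraMap Q E)
        = ((minpoly Q θ).map (algebraMap Q S)).map (algebraMap S E) := by
      rw [Polynomial.map_map, ← IsScalarTower.algebraMap_eq]
    rw [this] at hx1
    exact hQS.mem_range_of_isRoot (i := algebraMap S E)
      (Polynomial.map_ne_zero (minpoly.ne_zero hi)) (by simpa using isRoot_of_mem_roots hx1)
  have hl := hsp.mem_lift_of_roots_mem_range (hmon.map _) (algebraMap S E) hroots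
  obtain ⟨q, hq⟩ := (mem_lifts _).mp hl
  let D : IntermediateField Q E := A ⊓ S
  have hl2 : (minpoly A θ).map (algebraMap A E) ∈ lifts (algebraMap D E) := by
    rw [lifts_iff_coeff_lifts]
    intro n
    refine ⟨⟨((minpoly A θ).map (algebraMap A E)).coeff n, ?_, ?_⟩, rfl⟩
    · rw [coeff_map]; exact ((minpoly A θ).coeff n).2
    · rw [← hq, coeff_map]; exact (q.coeff n).2
  obtain ⟨g, hg, hgd, hgm⟩ := lifts_and_natDegree_eq_and_monic hl2 (hmon.map _)
  rw [natDegree_map] at hgd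
  apply le_antisymm
  · rw [← hgd]
    apply natDegree_le_of_dvd _ hgm.ne_zero
    apply minpoly.dvd
    rw [aeval_def, ← eval_map, hg, eval_map, ← aeval_def, minpoly.aeval]
  · let : Algebra D A := (IntermediateField.inclusion (inf_le_left : A ⊓ S ≤ A)).toRingHom.toAlgebra
    have : IsScalarTower D A E := IsScalarTower.of_algebraMap_eq (fun x => rfl)
    have hiD : IsIntegral D θ := hi.tower_top
    have := natDegree_le_of_dvd (minpoly.dvd_map_of_isScalarTower D A θ)
      (Polynomial.map_ne_zero (minpoly.ne_zero hiD))
    rwa [natDegree_map] at this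

open IntermediateField in
theorem aux_step {Q E : Type*} [Field Q] [Field E] [Algebra Q E] (hE : IsQuasireal E)
    (A B S : IntermediateField Q E) [IsGalois Q S] [FiniteDimensional Q S]
    {p : ℕ} (hp : p.Prime) {α : E} (ha : α ^ p ∈ A) (hB : B = A ⊔ adjoin Q {α}) :
    Relation.ReflTransGen
      (fun A B : IntermediateField Q E =>
        ∃ h : A ≤ B, Module.finrank A (IntermediateField.extendScalars h) = 2)
      (A ⊓ S) (B ⊓ S) := by
  have : CharZero E := hE.1
  have : CharZero Q := (algebraMap Q E).charZero
  have hAB : A ≤ B := hB ▸ le_sup_left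
  have h : A ⊓ S ≤ B ⊓ S := inf_le_inf_right S hAB
  let D : IntermediateField Q E := A ⊓ S
  let M : IntermediateField D E := extendScalars h
  have hfin : FiniteDimensional Q (B ⊓ S : IntermediateField Q E) := 
    FiniteDimensional.of_injective (inclusion (inf_le_right : B ⊓ S ≤ S)).toLinearMap
      (inclusion_injective (inf_le_right : B ⊓ S ≤ S))
  have : FiniteDimensional Q M := hfin
  have : FiniteDimensional D M := FiniteDimensional.right Q D M
  have : CharZero D := (algebraMap D E).charZero
  have : Algebra.IsAlgebraic D M := Algebra.IsAlgebraic.of_finite D M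
  have : Algebra.IsSeparable D M := Algebra.IsAlgebraic.isSeparable_of_perfectField
  obtain ⟨θ, hθ⟩ := Field.exists_primitive_element D M
  have hdeg : Module.finrank D M = (minpoly D (θ : E)).natDegree := by
    rw [← (Field.primitive_element_iff_minpoly_natDegree_eq D θ).mp hθ]
    congr 1
    exact (minpoly.algebraMap_eq (algebraMap M E).injective θ).symm
  have hθM : (θ : E) ∈ B ⊓ S := θ.2
  obtain ⟨hsp, hd⟩ := aux_coeff A S hθM.2
  have hθB : (θ : E) ∈ A⟮α⟯ := by
    have : B ≤ (A⟮α⟯).restrictScalars Q := by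
      rw [hB]
      refine sup_le ?_ ?_
      · intro x hx
        exact A⟮α⟯.algebraMap_mem ⟨x, hx⟩
      · rw [adjoin_simple_le_iff]
        exact mem_adjoin_simple_self A α
    exact this hθM.1
  have key := aux_prime hE hp (a := (⟨α ^ p, ha⟩ : A)) rfl hθB hsp
  rw [← hd] at key
  change (minpoly D (θ : E)).natDegree = 1 ∨ (minpoly D (θ : E)).natDegree = 2 at key
  rw [← hdeg] at key
  rcases key with h1 | h2
  · have hbot : M = ⊥ := finrank_eq_one_iff.mp h1
    have : A ⊓ S = B ⊓ S := by
      apply le_antisymm h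
      intro x hx
      have hx' : x ∈ M := hx
      rw [hbot, IntermediateField.mem_bot] at hx'
      obtain ⟨y, rfl⟩ := hx'
      exact y.2
    rw [this]
  · exact Relation.ReflTransGen.single ⟨h, h2⟩

open IntermediateField in
theorem aux_radical {Q E : Type*} [Field Q] [Field E] [Algebra Q E] (hE : IsQuasireal E)
    (S : IntermediateField Q E) [IsGalois Q S] [FiniteDimensional Q S] (n : ℕ) :
    ∀ (α : E) (A : IntermediateField Q E), 0 < n → α ^ n ∈ A →
    Relation.ReflTransGen
      (fun A B : IntermediateField Q E =>
        ∃ h : A ≤ B, Module.finrank A (IntermediateField.extendScalars h) = 2)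
      (A ⊓ S) ((A ⊔ adjoin Q {α}) ⊓ S) := by
  induction n using Nat.recOnMul with
  | zero => intro α A h; exact absurd h (lt_irrefl 0)
  | one =>
    intro α A _ h
    rw [pow_one] at h
    have : A ⊔ adjoin Q {α} = A := sup_eq_left.mpr (by rw [adjoin_simple_le_iff]; exact h)
    rw [this]
  | prime p hp => intro α A _ h; exact aux_step hE A _ S hp h rfl
  | mul a b iha ihb =>
    intro α A hab h
    have ha : 0 < a := Nat.pos_of_mul_pos_right hab
    have hb : 0 < b := Nat.pos_of_mul_pos_left hab
    have h1 := ihb (α ^ a) A hb (by rwa [← pow_mul])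
    have h2 := iha α (A ⊔ adjoin Q {α ^ a}) ha
      ((le_sup_right : adjoin Q {α ^ a} ≤ _) (mem_adjoin_simple_self Q _))
    have h3 : A ⊔ adjoin Q {α ^ a} ⊔ adjoin Q {α} = A ⊔ adjoin Q {α} := by
      rw [sup_assoc]
      congr 1
      apply sup_eq_right.mpr
      rw [adjoin_simple_le_iff]
      exact pow_mem (mem_adjoin_simple_self Q α) a
    rw [h3] at h2
    exact h1.trans h2

/-- If `E` is quasireal, `L` is a repeated radical extension of `Q` inside `E` and
`S` is a finite Galois extension of `Q` inside `E`, then `L ∩ S` is a repeated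
quadratic extension of `Q`: there is a tower of degree-2 steps from `Q` to `L ∩ S`. -/
theorem stmt11 (Q E : Type*) [Field Q] [Field E] [Algebra Q E]
    (hEqr : IsQuasireal E)
    (L S : IntermediateField Q E)
    (hL : IsRepeatedRadical Q E ⊥ L)
    (hSgal : IsGalois Q S) (hSfin : FiniteDimensional Q S) :
    Relation.ReflTransGen
      (fun A B : IntermediateField Q E =>
        ∃ h : A ≤ B, Module.finrank A (IntermediateField.extendScalars h) = 2)
      ⊥ (L ⊓ S) := by
  induction hL with
  | refl => rw [bot_inf_eq]
  | tail _ hstep ih =>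
    obtain ⟨α, ⟨n, hn, hα⟩, rfl⟩ := hstep
    exact ih.trans (aux_radical hEqr S n α _ hn hα)
end

section
/- Let N be a finite group, σ an automorphism of N of prime order p, and M a σ-invariant subnormal subgroup of N. Suppose σ acts fixed-point-freely on each factor of some σ-invariant subnormal series from M up to N. Let M ⊆ R ⊆ N, and assume R is σ-invariant if p > 2. Then R is subnormal in N, and R is σ-invariant even when p = 2. -/
/-- `c 0 ⊴ c 1 ⊴ ⋯ ⊴ c r`: a chain of subgroups, each normal in the next. -/
def IsNormalChain {N : Type*} [Group N] (c : ℕ → Subgroup N) (r : ℕ) : Prop :=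
  ∀ i < r, c i ≤ c (i + 1) ∧ ∀ x ∈ c (i + 1), ∀ m ∈ c i, x * m * x⁻¹ ∈ c i


namespace Th
open Subgroup

/-- `G` has a normal `q`-complement. -/
def QNil (q : ℕ) (G : Type*) [Group G] : Prop :=
  ∃ K : Subgroup G, K.Normal ∧ (Nat.card K).Coprime q ∧ ∃ k, K.index = q ^ k

theorem QNil.of_injective {q : ℕ} [hq : Fact q.Prime] {G H : Type*} [Group G] [Group H] [Finite G]
    (f : H →* G) (hf : Function.Injective f) (h : QNil q G) : QNil q H := by
  obtain ⟨K, hK, hc, k, hk⟩ := h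
  refine ⟨K.comap f, hK.comap f, ?_, ?_⟩
  · have h1 : Nat.card (K.comap f) ∣ Nat.card K := by
      have := Nat.card_congr ((K.comap f).equivMapOfInjective f hf).toEquiv
      rw [this]
      exact card_dvd_of_le (map_comap_le f K)
    exact Nat.Coprime.coprime_dvd_left h1 hc
  · have h1 : (K.comap f).index ∣ q ^ k := by
      rw [← hk, index_comap]
      exact relIndex_dvd_index_of_normal _ _
    obtain ⟨j, _, hj⟩ := (Nat.dvd_prime_pow hq.out).1 h1
    exact ⟨j, hj⟩

theorem QNil.of_surjective {q : ℕ} [hq : Fact q.Prime] {G H : Type*} [Group G] [Group H] [Finite G]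
    (f : G →* H) (hf : Function.Surjective f) (h : QNil q G) : QNil q H := by
  obtain ⟨K, hK, hc, k, hk⟩ := h
  refine ⟨K.map f, hK.map f hf, ?_, ?_⟩
  · exact Nat.Coprime.coprime_dvd_left (card_map_dvd K f) hc
  · have h1 : (K.map f).index ∣ q ^ k := by
      rw [← hk]; exact index_map_dvd K hf
    obtain ⟨j, _, hj⟩ := (Nat.dvd_prime_pow hq.out).1 h1
    exact ⟨j, hj⟩

theorem QNil.of_le {q : ℕ} [hq : Fact q.Prime] {G : Type*} [Group G] [Finite G] {A B : Subgroup G}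
    (hAB : A ≤ B) (h : QNil q B) : QNil q A :=
  h.of_injective (inclusion hAB) (inclusion_injective hAB)

/-- elements of the complement -/
theorem mem_compl_iff {q : ℕ} {G : Type*} [Group G] {K : Subgroup G} (hK : K.Normal)
    (hc : (Nat.card K).Coprime q) {k : ℕ} (hk : K.index = q ^ k) (x : G) :
    x ∈ K ↔ (orderOf x).Coprime q := by
  constructor
  · intro h
    exact Nat.Coprime.coprime_dvd_left (Subgroup.orderOf_dvd_natCard K h) hc
  · intro h
    have h1 : orderOf (x : G ⧸ K) ∣ orderOf x := orderOf_map_dvd (QuotientGroup.mk' K) x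
    have h2 : orderOf (x : G ⧸ K) ∣ q ^ k := by
      rw [← hk]; exact _root_.orderOf_dvd_natCard _
    have h3 : orderOf (x : G ⧸ K) = 1 :=
      Nat.eq_one_of_dvd_coprimes (Nat.Coprime.pow_right k h) h1 h2
    rw [orderOf_eq_one_iff] at h3
    exact (QuotientGroup.eq_one_iff x).1 h3

theorem QNil.of_isPGroup {q : ℕ} [hq : Fact q.Prime] {G : Type*} [Group G] [Finite G]
    (h : IsPGroup q G) : QNil q G := by
  obtain ⟨n, hn⟩ := IsPGroup.iff_card.1 h
  exact ⟨⊥, inferInstance, by simp, n, by simpa using hn⟩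

theorem QNil.of_coprime {q : ℕ} {G : Type*} [Group G]
    (h : (Nat.card G).Coprime q) : QNil q G :=
  ⟨⊤, inferInstance, by simpa using h, 0, by simp⟩

/-- extension by a normal subgroup of order coprime to q -/
theorem QNil.of_quot {q : ℕ} {G : Type*} [Group G] [Finite G] (O : Subgroup G)
    [O.Normal] (hO : (Nat.card O).Coprime q) (h : QNil q (G ⧸ O)) : QNil q G := by
  obtain ⟨K, hK, hc, k, hk⟩ := h
  have hs := QuotientGroup.mk'_surjective O
  refine ⟨K.comap (QuotientGroup.mk' O), hK.comap _, ?_, k, ?_⟩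
  · have h1 := card_mul_index (K.comap (QuotientGroup.mk' O))
    have h2 := card_mul_index K
    have h3 := card_mul_index O
    rw [index_comap_of_surjective K hs] at h1
    have h4 : O.index = Nat.card (G ⧸ O) := rfl
    have h5 : Nat.card (K.comap (QuotientGroup.mk' O)) = Nat.card K * Nat.card O := by
      have : 0 < K.index := Nat.pos_of_ne_zero (index_ne_zero_of_finite)
      apply Nat.eq_of_mul_eq_mul_right this
      rw [h1, ← h3, h4, ← h2]; ring
    rw [h5]; exact Nat.Coprime.mul_left hc hO
  · rw [index_comap_of_surjective K hs, hk]

/-- nilpotent groups -/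
theorem QNil.of_nilpotent {q : ℕ} [hq : Fact q.Prime] {G : Type*} [Group G] [Finite G]
    (h : Group.IsNilpotent G) : QNil q G := by
  by_cases hd : q ∣ Nat.card G
  · obtain ⟨e⟩ := (Group.isNilpotent_of_finite_tfae (G := G).out 0 4 rfl rfl).1 h
    have hmem : q ∈ (Nat.card G).primeFactors :=
      Nat.mem_primeFactors.2 ⟨hq.out, hd, Nat.card_pos.ne'⟩
    let P0 : Sylow q G := default
    let f : G →* P0 := (Pi.evalMonoidHom (fun P : Sylow q G => (P : Subgroup G)) P0).comp
      ((Pi.evalMonoidHom (fun p : (Nat.card G).primeFactors => ∀ P : Sylow p G, (P : Subgroup G))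
        ⟨q, hmem⟩).comp e.symm.toMonoidHom)
    have hf : Function.Surjective f := by
      intro y
      classical
      obtain ⟨z, hz⟩ := Function.surjective_eval (β := fun P : Sylow q G => (P : Subgroup G)) P0 y
      obtain ⟨w, hw⟩ := Function.surjective_eval (β := fun p : (Nat.card G).primeFactors =>
        ∀ P : Sylow p G, (P : Subgroup G)) ⟨q, hmem⟩ z
      refine ⟨e w, ?_⟩
      simp only [f, MonoidHom.comp_apply]
      have : e.symm.toMonoidHom (e w) = w := e.symm_apply_apply w
      rw [this]
      simp only [Function.eval] at hz hw
      simp [hw, hz]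
    obtain ⟨n, hn⟩ := IsPGroup.iff_card.1 P0.isPGroup'
    have hi : f.ker.index = Nat.card P0 := by
      rw [index_ker, MonoidHom.range_eq_top.2 hf]; simp
    refine ⟨f.ker, inferInstance, ?_, n, hi.trans hn⟩
    have h1 := card_mul_index f.ker
    have h2 := card_mul_index (P0 : Subgroup G)
    have h3 : Nat.card f.ker = (P0 : Subgroup G).index := by
      have : 0 < Nat.card P0 := Nat.card_pos
      apply Nat.eq_of_mul_eq_mul_right this
      rw [← hi, h1, hi, mul_comm, h2]
    rw [h3, Nat.coprime_comm]
    exact (Nat.Prime.coprime_iff_not_dvd hq.out).2 P0.not_dvd_index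
  · exact QNil.of_coprime (Nat.coprime_comm.1 ((Nat.Prime.coprime_iff_not_dvd hq.out).2 hd))

/-- the complement of a normal `q`-nilpotent subgroup gives a normal subgroup. -/
theorem QNil.exists_normal {q : ℕ} {G : Type*} [Group G] {C : Subgroup G}
    (hC : C.Normal) (h : QNil q C) : ∃ O : Subgroup G, O.Normal ∧ O ≤ C ∧ (Nat.card O).Coprime q ∧
      (∃ k, O.relIndex C = q ^ k) ∧ ∀ x ∈ C, (orderOf x).Coprime q → x ∈ O := by
  obtain ⟨K, hK, hc, k, hk⟩ := h
  have key := mem_compl_iff hK hc hk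
  have hm : ∀ x, x ∈ K.map C.subtype ↔ x ∈ C ∧ (orderOf x).Coprime q := by
    intro x
    constructor
    · rintro ⟨y, hy, rfl⟩
      refine ⟨y.2, ?_⟩
      have := (key y).1 hy
      simpa using this
    · rintro ⟨hx, ho⟩
      refine ⟨⟨x, hx⟩, (key _).2 ?_, rfl⟩
      simpa using ho
  refine ⟨K.map C.subtype, ⟨?_⟩, ?_, ?_, ⟨k, ?_⟩, ?_⟩
  · intro x hx g
    rw [hm] at hx ⊢
    refine ⟨hC.conj_mem _ hx.1 g, ?_⟩
    have : orderOf (g * x * g⁻¹) = orderOf x := orderOf_injective (MulAut.conj g).toMonoidHom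
      (MulAut.conj g).injective x
    rw [this]; exact hx.2
  · exact map_subtype_le K
  · rw [card_map_of_injective C.subtype_injective]; exact hc
  · rw [← hk, relIndex, subgroupOf, comap_map_eq_self_of_injective C.subtype_injective]
  · intro x hx ho
    exact (hm x).2 ⟨hx, ho⟩

theorem isPGroup_of_coprime_card_quot {q : ℕ} [hq : Fact q.Prime] {G : Type*} [Group G] [Finite G]
    {A : Subgroup G} (h1 : IsPGroup q A) (h2 : (Nat.card A).Coprime q) : A = ⊥ := by
  obtain ⟨n, hn⟩ := IsPGroup.iff_card.1 h1
  rw [hn] at h2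
  apply Subgroup.eq_bot_of_card_eq
  rw [hn]
  rcases Nat.eq_zero_or_pos n with h | h
  · simp [h]
  · rw [Nat.coprime_pow_left_iff h, Nat.coprime_self] at h2
    exact absurd h2 hq.out.one_lt.ne'

end Th

namespace Th
open Subgroup

theorem growth {q : ℕ} [hq : Fact q.Prime] {G : Type*} [Group G] [Finite G] {D P : Subgroup G}
    (hP : IsPGroup q P) (hDP : D ≤ P) (hne : D ≠ P) :
    ∃ x ∈ P, x ∉ D ∧ x ∈ normalizer (D : Set G) := by
  have hn : Group.IsNilpotent P := hP.isNilpotent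
  have h1 : D.subgroupOf P < ⊤ := by
    rw [lt_top_iff_ne_top, Ne, subgroupOf_eq_top]
    intro h; exact hne (le_antisymm hDP h)
  have h2 := Group.normalizerCondition_of_isNilpotent (G := P) _ h1
  obtain ⟨x, hx, hx'⟩ := SetLike.exists_of_lt h2
  refine ⟨x, x.2, fun h => hx' (mem_subgroupOf.2 h), ?_⟩
  rw [mem_normalizer_iff] at hx ⊢
  intro h
  constructor
  · intro hh
    have := (hx ⟨h, hDP hh⟩).1 (mem_subgroupOf.2 hh)
    simpa [mem_subgroupOf] using this
  · intro hh
    have hhP : h ∈ P := by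
      have := P.mul_mem (P.mul_mem (P.inv_mem x.2) (hDP hh)) x.2
      simpa [mul_assoc] using this
    have := (hx ⟨h, hhP⟩).2 (by rw [mem_subgroupOf]; simpa using hh)
    simpa [mem_subgroupOf] using this

theorem compl_sup_sylow {q : ℕ} [hq : Fact q.Prime] {G : Type*} [Group G] [Finite G]
    {K : Subgroup G} {k : ℕ} (hk : K.index = q ^ k) (S : Sylow q G) :
    (K ⊔ S : Subgroup G) = ⊤ := by
  rw [← index_eq_one]
  have h1 : (K ⊔ S : Subgroup G).index ∣ q ^ k := hk ▸ index_dvd_of_le le_sup_left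
  have h2 : (K ⊔ S : Subgroup G).index ∣ (S : Subgroup G).index := index_dvd_of_le le_sup_right
  have h3 : ((S : Subgroup G).index).Coprime q :=
    Nat.coprime_comm.1 ((Nat.Prime.coprime_iff_not_dvd hq.out).2 S.not_dvd_index)
  exact Nat.eq_one_of_dvd_coprimes (Nat.Coprime.pow_right k h3) h2 h1

theorem compl_conj {q : ℕ} [hq : Fact q.Prime] {G : Type*} [Group G] [Finite G]
    {K : Subgroup G} (hK : K.Normal) {k : ℕ} (hk : K.index = q ^ k) (S T : Sylow q G) :
    ∃ x ∈ K, x • S = T := by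
  obtain ⟨g, hg⟩ := MulAction.exists_smul_eq G S T
  have hg' : g ∈ K ⊔ (S : Subgroup G) := by rw [compl_sup_sylow hk S]; trivial
  obtain ⟨x, hx, s, hs, rfl⟩ := mem_sup_of_normal_left.1 hg'
  refine ⟨x, hx, ?_⟩
  rw [← hg, mul_smul]
  congr 1
  symm
  rw [Sylow.smul_eq_iff_mem_normalizer]
  exact le_normalizer hs

theorem coprime_disjoint {q : ℕ} [hq : Fact q.Prime] {G : Type*} [Group G] [Finite G]
    {K D : Subgroup G} (hc : (Nat.card K).Coprime q) (hD : IsPGroup q D) : Disjoint K D := by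
  obtain ⟨n, hn⟩ := IsPGroup.iff_card.1 hD
  apply Subgroup.disjoint_of_coprime_natCard
  rw [hn]; exact Nat.Coprime.pow_right n hc

theorem frob_conj {q : ℕ} [hq : Fact q.Prime] {G : Type*} [Group G] [Finite G]
    (h : ∀ U : Subgroup G, U ≠ ⊥ → IsPGroup q U → QNil q (normalizer (U : Set G))) :
    ∀ (n : ℕ) (P Q : Sylow q G), Nat.card G - Nat.card (P ⊓ Q : Subgroup G) ≤ n →
      ∃ c : G, (∀ d ∈ (P ⊓ Q : Subgroup G), d * c = c * d) ∧ c • P = Q := by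
  intro n
  induction n with
  | zero =>
    intro P Q hn
    have h1 : Nat.card (P ⊓ Q : Subgroup G) = Nat.card G :=
      le_antisymm (card_le_card_group _) (by omega)
    have h2 := (card_eq_iff_eq_top _).1 h1
    refine ⟨1, by simp, ?_⟩
    rw [one_smul]
    apply Sylow.ext
    rw [inf_eq_top_iff] at h2
    rw [h2.1, h2.2]
  | succ n ih =>
    intro P Q hn
    set D : Subgroup G := P ⊓ Q with hD
    by_cases hb : D = ⊥
    · obtain ⟨g, hg⟩ := MulAction.exists_smul_eq G P Q
      refine ⟨g, ?_, hg⟩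
      rw [hb]; intro d hd; rw [mem_bot.1 hd]; simp
    by_cases hP : D = P
    · refine ⟨1, by simp, ?_⟩
      rw [one_smul]
      have : (P : Subgroup G) ≤ Q := by rw [← hP]; exact inf_le_right
      exact Sylow.ext (P.is_maximal' Q.isPGroup' this).symm
    by_cases hQ : D = Q
    · refine ⟨1, by simp, ?_⟩
      rw [one_smul]
      have : (Q : Subgroup G) ≤ P := by rw [← hQ]; exact inf_le_left
      exact Sylow.ext (Q.is_maximal' P.isPGroup' this)
    have hDp : IsPGroup q D := P.isPGroup'.to_le inf_le_left
    have hh := h D hb hDp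
    set N := normalizer (D : Set G) with hN
    obtain ⟨K, hK, hc, k, hk⟩ := hh
    obtain ⟨a, haP, haD, haN⟩ := growth P.isPGroup' inf_le_left hP
    obtain ⟨b, hbQ, hbD, hbN⟩ := growth Q.isPGroup' inf_le_right hQ
    obtain ⟨S, hS⟩ := (P.isPGroup'.comap_subtype (K := N)).exists_le_sylow
    obtain ⟨T, hT⟩ := (Q.isPGroup'.comap_subtype (K := N)).exists_le_sylow
    obtain ⟨x, hxK, hxS⟩ := compl_conj hK hk S T
    obtain ⟨X, hX⟩ := (S.isPGroup'.map N.subtype).exists_le_sylow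
    have hDN : D ≤ N := le_normalizer
    -- x centralizes D
    have hxc : ∀ d ∈ D, d * (x : G) = x * d := by
      intro d hd
      have hDn : (D.subgroupOf N).Normal := by
        rw [hN]; infer_instance
      have hdis : Disjoint K (D.subgroupOf N) := coprime_disjoint hc hDp.comap_subtype
      have := commute_of_normal_of_disjoint K (D.subgroupOf N) hK hDn hdis x ⟨d, hDN hd⟩ hxK
        (mem_subgroupOf.2 hd)
      have := congrArg Subtype.val this.eq
      simpa using this.symm
    have hAX : ∀ y, y ∈ N → y ∈ P → y ∈ X := fun y h1 h2 =>
      hX ⟨⟨y, h1⟩, hS (mem_subgroupOf.2 h2), rfl⟩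
    have hBX : ∀ y, y ∈ N → y ∈ Q → y ∈ ((x : G) • X : Sylow q G) := by
      intro y h1 h2
      have h3 : (⟨y, h1⟩ : N) ∈ T := hT (mem_subgroupOf.2 h2)
      rw [← hxS] at h3
      have h4 : (⟨y, h1⟩ : N) ∈ ((x • S : Sylow q N) : Subgroup N) := h3
      rw [Sylow.coe_subgroup_smul, mem_pointwise_smul_iff_inv_smul_mem] at h4
      have h5 : y ∈ (((x:G) • X : Sylow q G) : Subgroup G) := by
        rw [Sylow.coe_subgroup_smul, mem_pointwise_smul_iff_inv_smul_mem]
        have := hX ⟨_, h4, rfl⟩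
        simpa [MulAut.smul_def] using this
      exact h5
    have hDlt : ∀ E : Subgroup G, D ≤ E → ∀ y ∈ E, y ∉ D → Nat.card D < Nat.card E := by
      intro E hE y hy hy'
      exact Set.ncard_lt_ncard (s := (D : Set G)) (t := (E : Set G))
        ⟨hE, fun h => hy' (h hy)⟩ (Set.toFinite _)
    have hle1 : D ≤ (P ⊓ X : Subgroup G) := fun d hd => ⟨hd.1, hAX d (hDN hd) hd.1⟩
    have hle2 : D ≤ (((x:G) • X : Sylow q G) ⊓ Q : Subgroup G) :=
      fun d hd => ⟨hBX d (hDN hd) hd.2, hd.2⟩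
    have hl1 := hDlt _ hle1 a ⟨haP, hAX a haN haP⟩ haD
    have hl2 := hDlt _ hle2 b ⟨hBX b hbN hbQ, hbQ⟩ hbD
    obtain ⟨c1, hc1, hc1'⟩ := ih P X (by omega)
    obtain ⟨c2, hc2, hc2'⟩ := ih ((x:G) • X) Q (by omega)
    refine ⟨c2 * x * c1, ?_, ?_⟩
    · intro d hd
      have e1 := hc1 d (hle1 hd)
      have e2 := hc2 d (hle2 hd)
      have e3 := hxc d hd
      calc d * (c2 * x * c1) = (d * c2) * x * c1 := by group
        _ = c2 * (d * x) * c1 := by rw [e2]; group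
        _ = c2 * x * (d * c1) := by rw [e3]; group
        _ = _ := by rw [e1]; group
    · rw [mul_smul, mul_smul, hc1', hc2']

/-- fusion in `P` is controlled by `P`. -/
theorem frob_fusion {q : ℕ} [hq : Fact q.Prime] {G : Type*} [Group G] [Finite G]
    (h : ∀ U : Subgroup G, U ≠ ⊥ → IsPGroup q U → QNil q (normalizer (U : Set G)))
    (P : Sylow q G) (x g : G) (hx : x ∈ P) (hg : g⁻¹ * x * g ∈ P) :
    ∃ u ∈ P, g⁻¹ * x * g = u⁻¹ * x * u := by
  by_cases hPb : (P : Subgroup G) = ⊥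
  · have hx1 : x = 1 := by
      have : x ∈ (P : Subgroup G) := hx
      rw [hPb] at this; exact mem_bot.1 this
    exact ⟨1, P.one_mem, by simp [hx1]⟩
  obtain ⟨c, hc, hc'⟩ := frob_conj h _ (g • P) P le_rfl
  have hxg : x ∈ ((g • P : Sylow q G) : Subgroup G) := by
    rw [Sylow.coe_subgroup_smul, mem_pointwise_smul_iff_inv_smul_mem]
    have hg2 : g⁻¹ * x * g ∈ (P : Subgroup G) := hg
    simpa [MulAut.smul_def] using hg2
  have hcx := hc x ⟨hxg, hx⟩
  have hn : c * g ∈ normalizer ((P : Subgroup G) : Set G) := by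
    rw [← mul_smul] at hc'
    exact Sylow.smul_eq_iff_mem_normalizer.1 hc'
  have hh := h P hPb P.isPGroup'
  set N := normalizer ((P : Subgroup G) : Set G) with hN
  obtain ⟨K, hK, hcop, k, hk⟩ := hh
  have hPN : (P : Subgroup G) ≤ N := le_normalizer
  have hPn : ((P : Subgroup G).subgroupOf N).Normal := by rw [hN]; infer_instance
  have hdis : Disjoint K ((P : Subgroup G).subgroupOf N) :=
    coprime_disjoint hcop P.isPGroup'.comap_subtype
  have hsup := compl_sup_sylow hk (P.subtype hPN)
  have hmem : (⟨c * g, hn⟩ : N) ∈ K ⊔ ((P.subtype hPN : Sylow q N) : Subgroup N) := by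
    rw [hsup]; trivial
  obtain ⟨y, hy, u, hu, hyu⟩ := mem_sup_of_normal_left.1 hmem
  have hu' : (u : G) ∈ P := hu
  have hyx : (y : G) * x = x * y := by
    have := commute_of_normal_of_disjoint K _ hK hPn hdis y ⟨x, hPN hx⟩ hy (mem_subgroupOf.2 hx)
    simpa using congrArg Subtype.val this.eq
  have hcg : c * g = y * u := by simpa using (congrArg Subtype.val hyu).symm
  refine ⟨u, hu', ?_⟩
  have hgg : g = c⁻¹ * y * u := by rw [mul_assoc, ← hcg]; group
  have e1 : c * x * c⁻¹ = x := by rw [← hcx]; group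
  have e2 : (y : G)⁻¹ * x * y = x := by rw [mul_assoc, ← hyx]; group
  calc g⁻¹ * x * g = (u : G)⁻¹ * ((y : G)⁻¹ * (c * x * c⁻¹) * y) * u := by rw [hgg]; group
    _ = _ := by rw [e1, e2]

end Th

namespace Th
open Subgroup

theorem mem_normalizer_of_conj {G : Type*} [Group G] [Finite G] {U : Subgroup G} {g : G}
    (h : ∀ u ∈ U, g * u * g⁻¹ ∈ U) : g ∈ normalizer (U : Set G) := by
  have h1 : U.map (MulAut.conj g).toMonoidHom ≤ U := by
    rintro _ ⟨u, hu, rfl⟩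
    simpa using h u hu
  have h2 : U.map (MulAut.conj g).toMonoidHom = U := by
    apply eq_of_le_of_card_ge h1
    rw [card_map_of_injective (MulAut.conj g).injective]
  rw [mem_normalizer_iff]
  intro u
  refine ⟨h u, fun hu => ?_⟩
  have h3 : g * u * g⁻¹ ∈ U.map (MulAut.conj g).toMonoidHom := by rw [h2]; exact hu
  obtain ⟨w, hw, hw'⟩ := h3
  have : w = u := by simpa using hw'
  rwa [← this]

theorem map_mem_normalizer {G H : Type*} [Group G] [Group H] [Finite G] {f : H →* G}
    {U : Subgroup H} {x : H} (hx : x ∈ normalizer (U : Set H)) :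
    f x ∈ normalizer ((U.map f : Subgroup G) : Set G) := by
  apply mem_normalizer_of_conj
  rintro _ ⟨u, hu, rfl⟩
  exact ⟨x * u * x⁻¹, (mem_normalizer_iff.1 hx u).1 hu, by simp⟩

theorem qnil_normalizer_map {q : ℕ} [hq : Fact q.Prime] {G H : Type*} [Group G] [Group H]
    [Finite G] {f : H →* G} (hf : Function.Injective f) {U : Subgroup H}
    (h : QNil q (normalizer ((U.map f : Subgroup G) : Set G))) :
    QNil q (normalizer (U : Set H)) := by
  let g : normalizer (U : Set H) →* normalizer ((U.map f : Subgroup G) : Set G) :=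
    (f.comp (normalizer (U : Set H)).subtype).codRestrict _ (fun x => map_mem_normalizer x.2)
  apply h.of_injective g
  intro a b hab
  have : f a = f b := congrArg Subtype.val hab
  exact Subtype.ext (hf this)

theorem qnil_of_normal {q : ℕ} {G : Type*} [Group G] {L : Subgroup G} (hL : L.Normal) {j : ℕ}
    (hj : L.index = q ^ j) (h : QNil q L) : QNil q G := by
  obtain ⟨O, hO, hOL, hc, ⟨k, hk⟩, -⟩ := h.exists_normal hL
  refine ⟨O, hO, hc, k + j, ?_⟩
  rw [← relIndex_mul_index hOL, hk, hj, pow_add]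

theorem frob_transfer {q : ℕ} [hq : Fact q.Prime] {G : Type*} [Group G] [Finite G]
    (h : ∀ U : Subgroup G, U ≠ ⊥ → IsPGroup q U → QNil q (normalizer (U : Set G)))
    (P : Sylow q G) (hP : (P : Subgroup G) ≠ ⊥) :
    ∃ L : Subgroup G, L.Normal ∧ L ≠ ⊤ ∧ ∃ j, L.index = q ^ j := by
  classical
  let V : G →* Abelianization P := (Abelianization.of (G := P)).transfer
  have key : ∀ x : P, V x = (Abelianization.of x) ^ (P : Subgroup G).index := by
    intro x
    let := (P : Subgroup G).fintypeQuotientOfFiniteIndex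
    have e := MonoidHom.transfer_eq_prod_quotient_orbitRel_zpowers_quot
      (Abelianization.of (G := P)) (x : G)
    change V x = _ at e
    rw [e, index_eq_sum_minimalPeriod (P : Subgroup G) (x : G), ← Finset.prod_pow_eq_pow_sum]
    refine Finset.prod_congr rfl fun c _ => ?_
    set n := Function.minimalPeriod ((x : G) • ·) (Quotient.out c) with hn
    obtain ⟨u, hu, hu'⟩ := frob_fusion h P ((x : G) ^ n) c.out.out (P.pow_mem x.2 n)
      (QuotientGroup.out_conj_pow_minimalPeriod_mem _ (x : G) c.out)
    have h2 : (⟨c.out.out⁻¹ * (x : G) ^ n * c.out.out,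
        QuotientGroup.out_conj_pow_minimalPeriod_mem _ (x : G) c.out⟩ : P) =
        (⟨u, hu⟩ : P)⁻¹ * x ^ n * ⟨u, hu⟩ := Subtype.ext hu'
    rw [h2, map_mul, map_mul, map_inv, map_pow, mul_comm, mul_inv_cancel_left]
  have hnil : Group.IsNilpotent P := P.isPGroup'.isNilpotent
  have hnt : Nontrivial (P : Subgroup G) := (nontrivial_iff_ne_bot _).2 hP
  have hAp : IsPGroup q (Abelianization P) := P.isPGroup'.of_surjective
    (Abelianization.of (G := P)) (QuotientGroup.mk'_surjective _)
  have hx : ∃ x : P, Abelianization.of x ≠ 1 := by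
    by_contra hcon
    push Not at hcon
    have hs : Group.IsSolvable P := inferInstance
    have := Group.IsSolvable.commutator_lt_top_of_nontrivial P
    refine this.ne (eq_top_iff.2 fun x _ => ?_)
    rw [← Abelianization.ker_of]
    exact hcon x
  obtain ⟨x, hx⟩ := hx
  refine ⟨V.ker, inferInstance, ?_, ?_⟩
  · intro ht
    have h1 : V x = 1 := by rw [← MonoidHom.mem_ker, ht]; trivial
    rw [key] at h1
    apply hx
    have h2 : orderOf (Abelianization.of x) ∣ (P : Subgroup G).index := orderOf_dvd_of_pow_eq_one h1
    obtain ⟨k, hk⟩ := hAp (Abelianization.of x)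
    have h3 := orderOf_dvd_of_pow_eq_one hk
    have h4 : ((P : Subgroup G).index).Coprime q :=
      Nat.coprime_comm.1 ((Nat.Prime.coprime_iff_not_dvd hq.out).2 P.not_dvd_index)
    exact orderOf_eq_one_iff.1 (Nat.eq_one_of_dvd_coprimes (Nat.Coprime.pow_right k h4) h2 h3)
  · rw [index_ker]
    exact IsPGroup.iff_card.1 (hAp.to_subgroup _)

theorem frobenius {q : ℕ} [hq : Fact q.Prime] : ∀ (n : ℕ) {G : Type*} [Group G] [Finite G],
    Nat.card G ≤ n →
    (∀ U : Subgroup G, U ≠ ⊥ → IsPGroup q U → QNil q (normalizer (U : Set G))) → QNil q G := by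
  intro n
  induction n with
  | zero => intro G _ _ hn; have := Nat.card_pos (α := G); omega
  | succ n ih =>
    intro G _ _ hn h
    let P : Sylow q G := default
    by_cases hP : (P : Subgroup G) = ⊥
    · apply QNil.of_coprime
      have := P.not_dvd_index
      rw [hP, index_bot] at this
      exact Nat.coprime_comm.1 ((Nat.Prime.coprime_iff_not_dvd hq.out).2 this)
    obtain ⟨L, hL, hLt, j, hj⟩ := frob_transfer h P hP
    apply qnil_of_normal hL hj
    have hlt : Nat.card L < Nat.card G :=
      lt_of_le_of_ne (card_le_card_group L) (fun hh => hLt ((card_eq_iff_eq_top L).1 hh))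
    apply ih (by omega)
    intro U hU hUp
    apply qnil_normalizer_map L.subtype_injective
    apply h
    · rwa [Ne, map_eq_bot_iff_of_injective _ L.subtype_injective]
    · exact hUp.map _

end Th

namespace Th
open Subgroup

theorem ring_key {R : Type*} [Ring R] {q : ℕ} [hq : Fact q.Prime] (hq2 : q ≠ 2)
    (hchar : (q : R) = 0) (b b' : R) (hbb : b * b' = 1) (hn : (b - 1) * (b - 1) = 0)
    (S : Set R) (hmul : ∀ x ∈ S, ∀ y ∈ S, x * y ∈ S) (hcomm : ∀ x ∈ S, ∀ y ∈ S, x * y = y * x)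
    (m : ℕ) (hm : m.Coprime q) (hfin : ∀ x ∈ S, x ^ m = 1)
    (hconj : ∀ x ∈ S, b * x * b' ∈ S) : ∀ x ∈ S, b * x = x * b := by
  have hodd : Odd q := hq.out.odd_of_ne_two hq2
  have hm0 : m ≠ 0 := by
    rintro rfl
    have : q = 1 := by simpa using hm
    exact hq.out.one_lt.ne' this
  obtain ⟨f, hf0, hf⟩ : ∃ f, 0 < f ∧ m ∣ q ^ f - 1 := by
    refine ⟨m.totient, Nat.totient_pos.2 (Nat.pos_of_ne_zero hm0), ?_⟩
    have := Nat.ModEq.pow_totient (Nat.coprime_comm.1 hm)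
    exact (Nat.modEq_iff_dvd' (Nat.one_le_pow _ _ hq.out.pos)).1 this.symm
  set Q := q ^ f with hQ
  have hQ1 : 1 < Q := Nat.one_lt_pow hf0.ne' hq.out.one_lt
  have hQodd : Odd Q := hodd.pow
  let E := Subring.closure S
  have hEc : ∀ x ∈ E, ∀ y ∈ E, x * y = y * x := by
    intro x hx y hy
    exact Subring.closure_induction₂ (p := fun x y _ _ => x * y = y * x)
      (fun x y hx hy => hcomm x hx y hy)
      (fun x _ => by simp) (fun x _ => by simp) (fun x _ => by simp) (fun x _ => by simp)
      (fun x y _ _ h => by rw [neg_mul, mul_neg, h]) (fun x y _ _ h => by rw [neg_mul, mul_neg, h])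
      (fun x y z _ _ _ h1 h2 => by rw [add_mul, mul_add, h1, h2])
      (fun x y z _ _ _ h1 h2 => by rw [add_mul, mul_add, h1, h2])
      (fun x y z _ _ _ h1 h2 => by rw [mul_assoc, h2, ← mul_assoc, h1, mul_assoc])
      (fun x y z _ _ _ h1 h2 => by rw [← mul_assoc, h1, mul_assoc, h2, mul_assoc]) hx hy
  have hpow : ∀ x ∈ E, x ^ Q = x := by
    intro x hx
    induction hx using Subring.closure_induction with
    | mem x hx =>
      obtain ⟨c, hc⟩ := hf
      have : Q = m * c + 1 := by omega
      rw [this, pow_succ, pow_mul, hfin x hx, one_pow, one_mul]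
    | zero => exact zero_pow (by omega)
    | one => exact one_pow _
    | neg x _ h => rw [hQodd.neg_pow, h]
    | mul x y hx hy h1 h2 =>
      have hc : Commute x y := hEc x hx y hy
      rw [hc.mul_pow, h1, h2]
    | add x y hx hy h1 h2 =>
      have hc : Commute x y := hEc x hx y hy
      obtain ⟨r, hr⟩ := hc.exists_add_pow_prime_pow_eq hq.out f
      rw [hr, ← hQ, h1, h2, hchar]; simp
  have hred : ∀ x ∈ E, x * x = 0 → x = 0 := by
    intro x hx h
    rw [← hpow x hx]
    obtain ⟨c, hc⟩ : ∃ c, Q = 2 + c := ⟨Q - 2, by omega⟩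
    rw [hc, pow_add, pow_two, h, zero_mul]
  have htwo : ∀ x : R, x + x = 0 → x = 0 := by
    intro x hx
    obtain ⟨c, hc⟩ := hodd
    have h1 : (q : R) * x = 0 := by rw [hchar, zero_mul]
    rw [hc] at h1
    push_cast at h1
    have : (2 * (c : R) + 1) * x = c * (x + x) + x := by noncomm_ring
    rw [this, hx] at h1
    simpa using h1
  set n := b - 1 with hnd
  have hb : b = 1 + n := by rw [hnd]; abel
  have hb' : b' = 1 - n := by
    have h1 : (1 - n) * b = 1 := by rw [hb]; have := hn; noncomm_ring; simp [hn]
    calc b' = ((1 - n) * b) * b' := by rw [h1, one_mul]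
      _ = _ := by rw [mul_assoc, hbb, mul_one]
  have h1 : ∀ x, b * x * b' = x + (n * x - x * n - n * x * n) := by
    intro x; rw [hb, hb']; noncomm_ring
  have hnxn : ∀ x ∈ S, n * x * n = 0 := by
    intro x hx
    have hx1 := hconj x hx
    have hx2 := hconj _ hx1
    have e : b * (b * x * b') * b' - (b * x * b') - (b * x * b') + x = - (n * x * n + n * x * n) := by
      rw [hb, hb']
      have e1 : ∀ y, n * (n * y) = 0 := fun y => by rw [← mul_assoc, hn, zero_mul]
      simp only [add_mul, mul_add, sub_mul, mul_sub, one_mul, mul_one, mul_assoc, hn, e1, mul_zero]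
      abel
    have hE : n * x * n + n * x * n ∈ E := by
      have : - (n * x * n + n * x * n) ∈ E := by
        rw [← e]
        exact E.add_mem (E.sub_mem (E.sub_mem (Subring.subset_closure hx2)
          (Subring.subset_closure hx1)) (Subring.subset_closure hx1)) (Subring.subset_closure hx)
      simpa using E.neg_mem this
    apply htwo
    apply hred _ hE
    have e1 : n * x * n * (n * x * n) = 0 := by
      calc _ = n * x * (n * n) * x * n := by noncomm_ring
        _ = 0 := by rw [hn]; simp
    rw [add_mul, mul_add, e1]; simp
  intro x hx
  have hd : n * x - x * n ∈ E := by
    have h2 := h1 x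
    rw [hnxn x hx, sub_zero] at h2
    have : n * x - x * n = b * x * b' - x := by rw [h2]; abel
    rw [this]
    exact E.sub_mem (Subring.subset_closure (hconj x hx)) (Subring.subset_closure hx)
  have h3 : n * x - x * n = 0 := by
    apply hred _ hd
    have e2 := hnxn _ (hmul x hx x hx)
    have e3 := hnxn x hx
    calc _ = (n * x * n) * x - n * (x * x) * n - x * (n * n) * x + x * (n * x * n) := by
          noncomm_ring
      _ = 0 := by rw [e2, e3, hn]; simp
  rw [hb, add_mul, mul_add, sub_eq_zero.1 h3]; simp

end Th

namespace Th
open Subgroup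

/-- Normalizers of nontrivial characteristic subgroups of `P` have normal `q`-complements. -/
def Hyp (q : ℕ) {G : Type*} [Group G] (P : Subgroup G) : Prop :=
  ∀ W : Subgroup P, W.Characteristic → W ≠ ⊥ →
    QNil q (normalizer ((W.map P.subtype : Subgroup G) : Set G))

theorem char_map {A B : Type*} [Group A] [Group B] (e : A ≃* B) {W : Subgroup A}
    (hW : W.Characteristic) : (W.map e.toMonoidHom).Characteristic := by
  rw [characteristic_iff_map_le] at hW ⊢
  rintro φ _ ⟨_, ⟨w, hw, rfl⟩, rfl⟩
  refine ⟨e.symm (φ (e w)), ?_, by simp⟩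
  exact hW ((e.trans φ).trans e.symm) ⟨w, hw, by simp⟩

theorem Hyp.comap {q : ℕ} [hq : Fact q.Prime] {G H : Type*} [Group G] [Group H] [Finite G]
    {f : H →* G} (hf : Function.Injective f) {Q : Subgroup H} (h : Hyp q (Q.map f)) : Hyp q Q := by
  intro W hW hne
  apply qnil_normalizer_map hf
  let e := Q.equivMapOfInjective f hf
  have h1 := h (W.map e.toMonoidHom) (char_map e hW) (by
    rwa [Ne, map_eq_bot_iff_of_injective _ e.injective])
  have : (W.map Q.subtype).map f = (W.map e.toMonoidHom).map (Q.map f).subtype := by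
    rw [map_map, map_map]; rfl
  rw [this]; exact h1

theorem Hyp.conj {q : ℕ} [hq : Fact q.Prime] {G : Type*} [Group G] [Finite G] (P Q : Sylow q G)
    (h : Hyp q (P : Subgroup G)) : Hyp q (Q : Subgroup G) := by
  obtain ⟨g, hg⟩ := MulAction.exists_smul_eq G Q P
  apply Hyp.comap (f := (MulAut.conj g).toMonoidHom) (MulAut.conj g).injective
  have : (Q : Subgroup G).map (MulAut.conj g).toMonoidHom = P := by
    rw [← hg]; rfl
  rw [this]; exact h

theorem char_normalizer_le {G : Type*} [Group G] [Finite G] {P : Subgroup G} {W : Subgroup P}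
    (hW : W.Characteristic) :
    normalizer (P : Set G) ≤ normalizer ((W.map P.subtype : Subgroup G) : Set G) := by
  intro x hx
  apply mem_normalizer_of_conj
  rintro _ ⟨w, hw, rfl⟩
  rw [characteristic_iff_map_le] at hW
  refine ⟨P.normalizerMonoidHom ⟨x, hx⟩ w, hW _ ⟨w, hw, rfl⟩, ?_⟩
  rfl

/-- a `q`-subgroup maximal in `N` as Sylow subgroup of `N` -/
theorem exists_sylow_of_max {q : ℕ} [hq : Fact q.Prime] {G : Type*} [Group G] [Finite G]
    {S N : Subgroup G} (hS : IsPGroup q S) (hSN : S ≤ N)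
    (hmax : ∀ T : Subgroup G, IsPGroup q T → T ≤ N → Nat.card T ≤ Nat.card S) :
    ∃ T : Sylow q N, (T : Subgroup N).map N.subtype = S := by
  obtain ⟨T, hT⟩ := (hS.comap_subtype (K := N)).exists_le_sylow
  refine ⟨T, (eq_of_le_of_card_ge ?_ ?_).symm⟩
  · intro s hs
    exact ⟨⟨s, hSN hs⟩, hT (mem_subgroupOf.2 hs), rfl⟩
  · exact hmax _ (T.isPGroup'.map _) (map_subtype_le _)

theorem card_lt_of_ne_top {G : Type*} [Group G] [Finite G] {L : Subgroup G} (h : L ≠ ⊤) :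
    Nat.card L < Nat.card G :=
  lt_of_le_of_ne (card_le_card_group L) (fun hh => h ((card_eq_iff_eq_top L).1 hh))

theorem step_a {q : ℕ} [hq : Fact q.Prime] {G : Type*} [Group G] [Finite G]
    (ih : ∀ L : Subgroup G, L ≠ ⊤ → ∀ S : Sylow q L, Hyp q (S : Subgroup L) → QNil q L)
    (P : Sylow q G) (hP : Hyp q (P : Subgroup G)) (hn : ¬ QNil q G) :
    ∃ U : Subgroup G, U ≠ ⊥ ∧ IsPGroup q U ∧ U.Normal := by
  classical
  have h0 : ∃ U : Subgroup G, U ≠ ⊥ ∧ IsPGroup q U ∧ ¬ QNil q (normalizer (U : Set G)) := by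
    by_contra hcon
    push Not at hcon
    exact hn (frobenius _ le_rfl hcon)
  obtain ⟨U0, hU0, hU0p, hU0n⟩ := h0
  let A : Set (Subgroup G × Subgroup G) := {x | x.1 ≠ ⊥ ∧ IsPGroup q x.1 ∧
    ¬ QNil q (normalizer (x.1 : Set G)) ∧ IsPGroup q x.2 ∧ x.2 ≤ normalizer (x.1 : Set G)}
  have hA : A.Nonempty := ⟨(U0, U0), hU0, hU0p, hU0n, hU0p, le_normalizer⟩
  obtain ⟨⟨U, S⟩, ⟨hU, hUp, hUn, hSp, hSN⟩, hmax⟩ :=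
    Set.exists_max_image A (fun x => Nat.card x.2) (Set.toFinite _) hA
  dsimp only at hU hUp hUn hSp hSN hmax
  refine ⟨U, hU, hUp, ?_⟩
  by_contra hnorm
  have hNt : normalizer (U : Set G) ≠ ⊤ := by rwa [Ne, normalizer_eq_top_iff]
  obtain ⟨T, hT⟩ := exists_sylow_of_max hSp hSN
    (fun T hT hTN => hmax (U, T) ⟨hU, hUp, hUn, hT, hTN⟩)
  apply hUn
  apply ih _ hNt T
  apply Hyp.comap (normalizer (U : Set G)).subtype_injective
  rw [hT]
  obtain ⟨P', hP'⟩ := hSp.exists_le_sylow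
  by_cases hSP : S = P'
  · rw [hSP]; exact Hyp.conj P P' hP
  intro W hW hWne
  by_contra hWn
  obtain ⟨x, hx, hxS, hxN⟩ := growth P'.isPGroup' hP' hSP
  set S' := S ⊔ zpowers x with hS'
  have hS'P : S' ≤ P' := sup_le hP' (by rw [zpowers_le]; exact hx)
  have hS'N : S' ≤ normalizer ((W.map S.subtype : Subgroup G) : Set G) := by
    refine le_trans (sup_le le_normalizer ?_) (char_normalizer_le hW)
    rw [zpowers_le]; exact hxN
  have := hmax (W.map S.subtype, S') ⟨by rwa [Ne, map_eq_bot_iff_of_injective _ S.subtype_injective],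
    hSp.to_le (map_subtype_le _), hWn, P'.isPGroup'.to_le hS'P, hS'N⟩
  have h2 : S = S' := eq_of_le_of_card_ge le_sup_left this
  apply hxS
  rw [h2]; exact mem_sup_right (mem_zpowers x)

/-- the largest normal `q`-subgroup -/
theorem exists_core (q : ℕ) [hq : Fact q.Prime] (G : Type*) [Group G] [Finite G] :
    ∃ H : Subgroup G, H.Normal ∧ IsPGroup q H ∧
      ∀ U : Subgroup G, U.Normal → IsPGroup q U → U ≤ H := by
  obtain ⟨H, ⟨h1, h2⟩, h3⟩ := Set.exists_max_image {H : Subgroup G | H.Normal ∧ IsPGroup q H}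
    (fun H => Nat.card H) (Set.toFinite _) ⟨⊥, inferInstance, IsPGroup.of_bot⟩
  refine ⟨H, h1, h2, fun U hU hUp => ?_⟩
  have h4 := h3 (H ⊔ U) ⟨inferInstance, h2.to_sup_of_normal_right hUp⟩
  have h5 : H = H ⊔ U := eq_of_le_of_card_ge le_sup_left h4
  rw [h5]; exact le_sup_right

theorem normal_le_sylow {q : ℕ} [hq : Fact q.Prime] {G : Type*} [Group G] [Finite G]
    {H : Subgroup G} (hH : H.Normal) (hp : IsPGroup q H) (P : Sylow q G) : H ≤ P := by
  have h1 : IsPGroup q (H ⊔ P : Subgroup G) := hp.to_sup_of_normal_left P.isPGroup'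
  have := P.is_maximal' h1 le_sup_right
  rw [← this]; exact le_sup_left

theorem step_b {q : ℕ} [hq : Fact q.Prime] {G : Type*} [Group G] [Finite G]
    (ih : ∀ L : Subgroup G, L ≠ ⊤ → ∀ S : Sylow q L, Hyp q (S : Subgroup L) → QNil q L)
    (P : Sylow q G) (hP : Hyp q (P : Subgroup G)) (L : Subgroup G) (hL : L ≠ ⊤)
    (hPL : (P : Subgroup G) ≤ L) : QNil q L := by
  apply ih L hL (P.subtype hPL)
  apply Hyp.comap L.subtype_injective
  have : ((P.subtype hPL : Sylow q L) : Subgroup L).map L.subtype = P := by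
    rw [Sylow.coe_subtype, subgroupOf_map_subtype, inf_eq_left.2 hPL]
  rw [this]; exact hP

theorem step_c {q : ℕ} [hq : Fact q.Prime] {G : Type*} [Group G] [Finite G]
    (hb : ∀ (P : Sylow q G) (L : Subgroup G), L ≠ ⊤ → (P : Subgroup G) ≤ L → QNil q L)
    (P : Sylow q G) (H : Subgroup G) [H.Normal] (hHp : IsPGroup q H)
    (hmax : ∀ U : Subgroup G, U.Normal → IsPGroup q U → U ≤ H)
    (ih : ∀ S : Sylow q (G ⧸ H), Hyp q (S : Subgroup (G ⧸ H)) → QNil q (G ⧸ H)) :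
    QNil q (G ⧸ H) := by
  have hs := QuotientGroup.mk'_surjective H
  apply ih (P.mapSurjective hs)
  intro W hW hWne
  set W1 := W.map (P.mapSurjective hs : Subgroup (G ⧸ H)).subtype with hW1
  have hne : W1 ≠ ⊥ := by
    rwa [Ne, map_eq_bot_iff_of_injective _ (Subgroup.subtype_injective _)]
  set L := (normalizer (W1 : Set (G ⧸ H))).comap (QuotientGroup.mk' H) with hL
  have hPL : (P : Subgroup G) ≤ L := by
    rw [hL, ← map_le_iff_le_comap]
    exact le_trans le_normalizer (char_normalizer_le hW)
  have hLt : L ≠ ⊤ := by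
    intro ht
    have h1 : normalizer (W1 : Set (G ⧸ H)) = ⊤ := by
      rw [eq_top_iff]
      intro x _
      obtain ⟨y, rfl⟩ := hs x
      have : y ∈ L := by rw [ht]; trivial
      exact this
    have h2 : W1.Normal := normalizer_eq_top_iff.1 h1
    have h3 : W1.comap (QuotientGroup.mk' H) ≤ H := by
      apply hmax _ (h2.comap _)
      apply IsPGroup.comap_of_ker_isPGroup
      · exact (P.mapSurjective hs).isPGroup'.to_le (map_subtype_le _)
      · rw [QuotientGroup.ker_mk']; exact hHp
    apply hne
    rw [eq_bot_iff]
    intro x hx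
    obtain ⟨y, rfl⟩ := hs x
    have : y ∈ H := h3 hx
    simpa using this
  have hq := hb P L hLt hPL
  let f : L →* normalizer (W1 : Set (G ⧸ H)) :=
    ((QuotientGroup.mk' H).comp L.subtype).codRestrict _ (fun x => x.2)
  apply hq.of_surjective f
  rintro ⟨x, hx⟩
  obtain ⟨y, rfl⟩ := hs x
  exact ⟨⟨y, hx⟩, rfl⟩

end Th

namespace Th
open Subgroup

theorem frattini_q {q : ℕ} [hq : Fact q.Prime] {G : Type*} [Group G] [Finite G]
    (O : Subgroup G) [hOn : O.Normal] (hO : (Nat.card O).Coprime q) (W : Subgroup G)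
    (hW : IsPGroup q W) (x : G)
    (hx : (QuotientGroup.mk' O x) ∈ normalizer ((W.map (QuotientGroup.mk' O) : Subgroup (G ⧸ O)) : Set (G ⧸ O))) :
    ∃ y ∈ O, y⁻¹ * x ∈ normalizer (W : Set G) := by
  set Y := W ⊔ O with hY
  have hWY : W ≤ Y := le_sup_left
  have hOY : O ≤ Y := le_sup_right
  have hc : ∀ w ∈ W, ∃ w' ∈ W, ∃ o ∈ O, x * w * x⁻¹ = w' * o := by
    intro w hw
    have h1 := (mem_normalizer_iff.1 hx (QuotientGroup.mk' O w)).1 ⟨w, hw, rfl⟩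
    obtain ⟨w', hw', he⟩ := h1
    rw [← map_inv, ← map_mul, ← map_mul] at he
    refine ⟨w', hw', w'⁻¹ * (x * w * x⁻¹), ?_, by group⟩
    exact QuotientGroup.eq.1 he
  set W2 := W.map (MulAut.conj x).toMonoidHom with hW2
  have hW2Y : W2 ≤ Y := by
    rintro _ ⟨w, hw, rfl⟩
    obtain ⟨w', hw', o, ho, he⟩ := hc w hw
    have : (MulAut.conj x).toMonoidHom w = w' * o := by simpa using he
    rw [this]
    exact Y.mul_mem (hWY hw') (hOY ho)
  have hindex : ∃ j, (O.subgroupOf Y).index = q ^ j := by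
    obtain ⟨n, hn⟩ := IsPGroup.iff_card.1 hW
    have h1 : (O.subgroupOf Y).index ∣ q ^ n := by
      change O.relIndex Y ∣ _
      rw [hY, relIndex_sup_right, ← hn]
      exact index_dvd_card _
    obtain ⟨j, _, hj⟩ := (Nat.dvd_prime_pow hq.out).1 h1
    exact ⟨j, hj⟩
  obtain ⟨j, hj⟩ := hindex
  have hKn : (O.subgroupOf Y).Normal := inferInstance
  obtain ⟨S, hS⟩ := (hW.comap_subtype (K := Y)).exists_le_sylow
  obtain ⟨T, hT⟩ := ((hW.map (MulAut.conj x).toMonoidHom).comap_subtype (K := Y)).exists_le_sylow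
  obtain ⟨y, hyK, hyS⟩ := compl_conj hKn hj S T
  have hyO : (y : G) ∈ O := hyK
  refine ⟨y, hyO, mem_normalizer_of_conj ?_⟩
  intro w hw
  obtain ⟨w', hw', o, ho, he⟩ := hc w hw
  have hdis : Disjoint O ((S : Subgroup Y).map Y.subtype) :=
    coprime_disjoint hO (S.isPGroup'.map _)
  have hxw : x * w * x⁻¹ ∈ Y := hW2Y ⟨w, hw, by simp⟩
  have h3 : (⟨x * w * x⁻¹, hxw⟩ : Y) ∈ T := hT (mem_subgroupOf.2 ⟨w, hw, by simp⟩)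
  rw [← hyS] at h3
  have h4 : (⟨x * w * x⁻¹, hxw⟩ : Y) ∈ ((y • S : Sylow q Y) : Subgroup Y) := h3
  rw [Sylow.coe_subgroup_smul, mem_pointwise_smul_iff_inv_smul_mem] at h4
  have h5 : (y : G)⁻¹ * (x * w * x⁻¹) * y ∈ (S : Subgroup Y).map Y.subtype :=
    ⟨_, h4, by simp [MulAut.smul_def]⟩
  have h6 : w' ∈ (S : Subgroup Y).map Y.subtype :=
    ⟨⟨w', hWY hw'⟩, hS (mem_subgroupOf.2 hw'), rfl⟩
  have h7 : w'⁻¹ * ((y : G)⁻¹ * (x * w * x⁻¹) * y) = 1 := by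
    apply disjoint_def.1 hdis _ (mul_mem (inv_mem h6) h5)
    rw [he]
    have : w'⁻¹ * ((y : G)⁻¹ * (w' * o) * y) = (w'⁻¹ * (y : G)⁻¹ * (w'⁻¹)⁻¹) * (o * y) := by group
    rw [this]
    exact O.mul_mem (hOn.conj_mem _ (O.inv_mem hyO) _) (O.mul_mem ho hyO)
  have h8 : (y : G)⁻¹ * x * w * ((y : G)⁻¹ * x)⁻¹ = w' := by
    rw [inv_mul_eq_one] at h7
    rw [h7]; group
  rw [h8]; exact hw'

theorem step_d {q : ℕ} [hq : Fact q.Prime] {G : Type*} [Group G] [Finite G]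
    (P : Sylow q G) (hP : Hyp q (P : Subgroup G)) (O : Subgroup G) [O.Normal]
    (hO : (Nat.card O).Coprime q)
    (ih : ∀ S : Sylow q (G ⧸ O), Hyp q (S : Subgroup (G ⧸ O)) → QNil q (G ⧸ O)) :
    QNil q (G ⧸ O) := by
  have hs := QuotientGroup.mk'_surjective O
  apply ih (P.mapSurjective hs)
  change Hyp q ((P : Subgroup G).map (QuotientGroup.mk' O))
  intro W hW hWne
  have hdis : Disjoint O (P : Subgroup G) := coprime_disjoint hO P.isPGroup'
  let e : (P : Subgroup G) ≃* (P : Subgroup G).map (QuotientGroup.mk' O) :=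
    MulEquiv.ofBijective ((QuotientGroup.mk' O).subgroupMap P)
      ⟨by
        rw [injective_iff_map_eq_one]
        intro a ha
        have h1 : QuotientGroup.mk' O (a : G) = 1 := congrArg Subtype.val ha
        have h2 : (a : G) ∈ O := by simpa using h1
        exact Subtype.ext (disjoint_def.1 hdis h2 a.2),
      (QuotientGroup.mk' O).subgroupMap_surjective P⟩
  have he : ∀ a, ((e a : _) : G ⧸ O) = QuotientGroup.mk' O a := fun a => rfl
  set W0 := W.map e.symm.toMonoidHom with hW0
  have h1 := hP W0 (char_map e.symm hW) (by
    rwa [Ne, map_eq_bot_iff_of_injective _ e.symm.injective])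
  set Wg := W0.map (P : Subgroup G).subtype with hWg
  set W1 := W.map ((P : Subgroup G).map (QuotientGroup.mk' O)).subtype with hW1
  have hm : Wg.map (QuotientGroup.mk' O) = W1 := by
    ext z
    constructor
    · rintro ⟨_, ⟨_, ⟨w, hw, rfl⟩, rfl⟩, rfl⟩
      refine ⟨w, hw, ?_⟩
      have := he (e.symm w)
      rw [e.apply_symm_apply] at this
      exact this
    · rintro ⟨w, hw, rfl⟩
      refine ⟨_, ⟨_, ⟨w, hw, rfl⟩, rfl⟩, ?_⟩
      have := he (e.symm w)
      rw [e.apply_symm_apply] at this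
      exact this.symm
  have hWp : IsPGroup q Wg := P.isPGroup'.to_le (map_subtype_le _)
  let f : normalizer (Wg : Set G) →* normalizer (W1 : Set (G ⧸ O)) :=
    ((QuotientGroup.mk' O).comp (normalizer (Wg : Set G)).subtype).codRestrict _ (fun x => by
      rw [← hm]; exact map_mem_normalizer x.2)
  apply h1.of_surjective f
  rintro ⟨x, hx⟩
  obtain ⟨x, rfl⟩ := hs x
  rw [← hm] at hx
  obtain ⟨y, hy, hyx⟩ := frattini_q O hO Wg hWp x hx
  refine ⟨⟨_, hyx⟩, Subtype.ext ?_⟩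
  change QuotientGroup.mk' O (y⁻¹ * x) = QuotientGroup.mk' O x
  have : QuotientGroup.mk' O y = 1 := by simpa using hy
  rw [map_mul, map_inv, this]; simp

/-- central Sylow subgroup -/
theorem qnil_of_central {q : ℕ} [hq : Fact q.Prime] {A : Type*} [Group A] [Finite A]
    (Z : Subgroup A) (hZ : Z ≤ center A) (hZp : IsPGroup q Z) (hi : ¬ q ∣ Z.index) : QNil q A := by
  let P : Sylow q A := hZp.toSylow hi
  have hPZ : (P : Subgroup A) = Z := rfl
  have hc : normalizer ((P : Subgroup A) : Set A) ≤ centralizer ((P : Subgroup A) : Set A) := by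
    intro x _
    rw [mem_centralizer_iff]
    intro z hz
    exact (mem_center_iff.1 (hZ hz) x).symm
  have h1 := MonoidHom.ker_transferSylow_isComplement' P hc
  obtain ⟨n, hn⟩ := IsPGroup.iff_card.1 hZp
  refine ⟨_, inferInstance, ?_, n, h1.symm.index_eq_card.trans hn⟩
  exact Nat.coprime_comm.1 ((Nat.Prime.coprime_iff_not_dvd hq.out).2
    (MonoidHom.not_dvd_card_ker_transferSylow P hc))

theorem relIndex_dvd_of_normal {G : Type*} [Group G] {H C K : Subgroup G} [H.Normal] (h : C ≤ K) :
    H.relIndex C ∣ H.relIndex K := by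
  rw [← QuotientGroup.ker_mk' H, relIndex_ker, relIndex_ker]
  exact card_dvd_of_le (map_mono h)

/-- (e) -/
theorem step_e {q : ℕ} [hq : Fact q.Prime] {G : Type*} [Group G] [Finite G]
    (H K : Subgroup G) [hHn : H.Normal] [hKn : K.Normal] (hHp : IsPGroup q H)
    (hmax : ∀ U : Subgroup G, U.Normal → IsPGroup q U → U ≤ H)
    (hO : ∀ O : Subgroup G, O.Normal → (Nat.card O).Coprime q → O = ⊥)
    (hcop : (H.relIndex K).Coprime q) : 
    centralizer (H : Set G) ⊓ K ≤ H := by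
  set C := centralizer (H : Set G) ⊓ K with hC
  have hCn : C.Normal := inferInstance
  have hi : (H.relIndex C).Coprime q := by
    apply Nat.Coprime.coprime_dvd_left _ hcop
    exact relIndex_dvd_of_normal inf_le_right
  have hq : QNil q C := by
    apply qnil_of_central (H.subgroupOf C)
    · intro z hz
      rw [mem_center_iff]
      intro g
      have := mem_centralizer_iff.1 g.2.1 z hz
      exact Subtype.ext this.symm
    · exact hHp.comap_subtype
    · exact (Nat.Prime.coprime_iff_not_dvd hq.out).1 (Nat.coprime_comm.1 hi)
  obtain ⟨O, hOn, hOC, hc, ⟨k, hk⟩, -⟩ := hq.exists_normal hCn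
  rw [hO O hOn hc, relIndex_bot_left] at hk
  exact hmax C hCn (IsPGroup.of_card hk)

end Th

namespace Th
open Subgroup

theorem mem_of_coprime {q : ℕ} {G : Type*} [Group G] {K : Subgroup G} (hK : K.Normal)
    {k : ℕ} (hk : K.index = q ^ k) {x : G} (h : (orderOf x).Coprime q) : x ∈ K := by
  have h1 : orderOf (x : G ⧸ K) ∣ orderOf x := orderOf_map_dvd (QuotientGroup.mk' K) x
  have h2 : orderOf (x : G ⧸ K) ∣ q ^ k := by
    rw [← hk]; exact _root_.orderOf_dvd_natCard _
  have h3 : orderOf (x : G ⧸ K) = 1 :=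
    Nat.eq_one_of_dvd_coprimes (Nat.Coprime.pow_right k h) h1 h2
  rw [orderOf_eq_one_iff] at h3
  exact (QuotientGroup.eq_one_iff x).1 h3

theorem eq_one_of_coprime {q : ℕ} [hq : Fact q.Prime] {G : Type*} [Group G] {H : Subgroup G}
    (hH : IsPGroup q H) {x : G} (hx : x ∈ H) (h : (orderOf x).Coprime q) : x = 1 := by
  obtain ⟨k, hk⟩ := hH ⟨x, hx⟩
  have h2 : orderOf x ∣ q ^ k := orderOf_dvd_of_pow_eq_one (congrArg Subtype.val hk)
  exact orderOf_eq_one_iff.1 (Nat.eq_one_of_dvd_coprimes (Nat.Coprime.pow_right k h) dvd_rfl h2)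

theorem step_f {q : ℕ} [hq : Fact q.Prime] {G : Type*} [Group G] [Finite G] (P : Subgroup G)
    (hP : IsPGroup q P) (hb : ∀ (L : Subgroup G), L ≠ ⊤ → (P : Subgroup G) ≤ L → QNil q L)
    (H K : Subgroup G) [hHn : H.Normal] [hKn : K.Normal] (hHp : IsPGroup q H)
    {k : ℕ} (hk : K.index = q ^ k) (hcop : (H.relIndex K).Coprime q)
    (hCK : centralizer (H : Set G) ⊓ K ≤ H)
    (X : Subgroup G) (hHX : H ≤ X) (hXK : X ≤ K) (hPX : P ≤ normalizer (X : Set G)) :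
    X = H ∨ X = K := by
  have hcop2 : (X.relIndex K).Coprime q := Nat.Coprime.coprime_dvd_left
    (relIndex_dvd_of_le_left _ hHX) hcop
  by_cases ht : P ⊔ X = ⊤
  · right
    have hXn : X.Normal := by
      rw [← normalizer_eq_top_iff, eq_top_iff, ← ht]
      exact sup_le hPX le_normalizer
    have h1 : X.index ∣ Nat.card P := by
      rw [← relIndex_top_right, ← ht, relIndex_sup_right]
      exact relIndex_dvd_card _ _
    obtain ⟨n, hn⟩ := IsPGroup.iff_card.1 hP
    rw [hn] at h1
    have h2 := (relIndex_dvd_index_of_le hXK).trans h1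
    have h3 := Nat.eq_one_of_dvd_coprimes (Nat.Coprime.pow_right n hcop2) dvd_rfl h2
    exact le_antisymm hXK (relIndex_eq_one.1 h3)
  · left
    set L := P ⊔ X with hL
    have hXL : X ≤ L := le_sup_right
    obtain ⟨Y, hYn, hYc, j, hj⟩ := hb L ht le_sup_left
    have hdis : Disjoint Y (H.subgroupOf L) := coprime_disjoint hYc hHp.comap_subtype
    have hY : Y = ⊥ := by
      rw [eq_bot_iff]
      intro y hy
      have hoy : (orderOf (y : G)).Coprime q := by
        have := (mem_compl_iff hYn hYc hj y).1 hy
        simpa using this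
      have hyK : (y : G) ∈ K := mem_of_coprime hKn hk hoy
      have hyC : (y : G) ∈ centralizer (H : Set G) := by
        rw [mem_centralizer_iff]
        intro h hh
        have := commute_of_normal_of_disjoint Y _ hYn inferInstance hdis y ⟨h, hXL (hHX hh)⟩ hy
          (mem_subgroupOf.2 hh)
        simpa using (congrArg Subtype.val this.eq).symm
      have := eq_one_of_coprime hHp (hCK ⟨hyC, hyK⟩) hoy
      exact mem_bot.2 (Subtype.ext this)
    rw [hY, index_bot] at hj
    have hLp : IsPGroup q L := IsPGroup.of_card hj
    have hXp := hLp.to_le hXL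
    obtain ⟨n, hn⟩ := IsPGroup.iff_card.1 hXp
    have h1 : H.relIndex X ∣ q ^ n := hn ▸ relIndex_dvd_card _ _
    have h2 : (H.relIndex X).Coprime q := Nat.Coprime.coprime_dvd_left
      (relIndex_dvd_of_normal hXK) hcop
    have h3 := Nat.eq_one_of_dvd_coprimes (Nat.Coprime.pow_right n h2) dvd_rfl h1
    exact le_antisymm (relIndex_eq_one.1 h3) hHX

theorem min_abelian {q : ℕ} [hq : Fact q.Prime] {G : Type*} [Group G] [Finite G]
    (A : Subgroup G) [hAn : A.Normal] (hA : (Nat.card A).Coprime q) (P : Subgroup G)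
    (hP : IsPGroup q P)
    (hmin : ∀ X ≤ A, P ≤ normalizer (X : Set G) → X = ⊥ ∨ X = A) :
    ∀ x ∈ A, ∀ y ∈ A, x * y = y * x := by
  by_cases hAb : A = ⊥
  · rw [hAb]; intro x hx y hy; rw [mem_bot.1 hx, mem_bot.1 hy]
  have hA1 : Nat.card A ≠ 1 := fun h => hAb (eq_bot_of_card_eq A h)
  have : Fact (Nat.card A).minFac.Prime := ⟨Nat.minFac_prime hA1⟩
  set r := (Nat.card A).minFac with hr
  have hrA : r ∣ Nat.card A := Nat.minFac_dvd _
  letI act : MulDistribMulAction P A := MulDistribMulAction.compHom A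
    ((MulAut.conjNormal (H := A)).comp P.subtype)
  have hact : ∀ (x : P) (a : A), ((x • a : A) : G) = x * a * (x : G)⁻¹ := fun x a => rfl
  have hnd : ¬ q ∣ Nat.card (Sylow r A) := by
    intro h
    have h2 : q ∣ Nat.card A :=
      h.trans (((default : Sylow r A).card_dvd_index).trans (index_dvd_card _))
    exact (Nat.Prime.coprime_iff_not_dvd hq.out).1 (Nat.coprime_comm.1 hA) h2
  obtain ⟨R, hR⟩ := hP.nonempty_fixed_point_of_prime_not_dvd_card (Sylow r A) hnd
  have hAr : IsPGroup r A := by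
    rcases hmin ((R : Subgroup A).map A.subtype) (map_subtype_le _) (by
      intro x hx
      apply mem_normalizer_of_conj
      rintro _ ⟨a, ha, rfl⟩
      have h1 : (⟨x, hx⟩ : P) • R = R := hR ⟨x, hx⟩
      refine ⟨(⟨x, hx⟩ : P) • a, ?_, hact _ _⟩
      have h2 : (⟨x, hx⟩ : P) • a ∈ (((⟨x, hx⟩ : P) • R : Sylow r A) : Subgroup A) :=
        smul_mem_pointwise_smul a _ _ ha
      rw [h1] at h2
      exact h2) with h | h
    · rw [map_eq_bot_iff_of_injective _ A.subtype_injective] at h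
      have h1 := R.dvd_card_of_dvd_card hrA
      rw [h] at h1
      simp at h1
      exact absurd h1 (Fact.out (p := r.Prime)).one_lt.ne'
    · rw [← h]; exact R.isPGroup'.map _
  have hnt : Nontrivial A := (nontrivial_iff_ne_bot _).2 hAb
  have hc := hAr.center_nontrivial
  have hcn : ((center A).map A.subtype).Normal := inferInstance
  rcases hmin ((center A).map A.subtype) (map_subtype_le _) (by
    rw [normalizer_eq_top_iff.2 hcn]; exact le_top) with h | h
  · rw [map_eq_bot_iff_of_injective _ A.subtype_injective] at h
    exact absurd h ((nontrivial_iff_ne_bot _).1 hc)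
  · intro x hx y hy
    have h2 := hx
    rw [← h] at h2
    obtain ⟨z, hz, rfl⟩ := h2
    exact (congrArg Subtype.val (mem_center_iff.1 hz ⟨y, hy⟩)).symm

end Th

namespace Th
open Subgroup

def MaxAb {G : Type*} [Group G] (P A : Subgroup G) : Prop :=
  A ≤ P ∧ A ≤ centralizer (A : Set G) ∧
    ∀ B ≤ P, B ≤ centralizer (B : Set G) → Nat.card B ≤ Nat.card A

theorem sup_ab {G : Type*} [Group G] {M C : Subgroup G} (hM : M ≤ centralizer (M : Set G))
    (hC : C ≤ centralizer (C : Set G)) (h : C ≤ centralizer (M : Set G)) :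
    M ⊔ C ≤ centralizer ((M ⊔ C : Subgroup G) : Set G) := by
  refine sup_le ?_ ?_
  · rw [le_centralizer_iff]; exact sup_le hM h
  · rw [le_centralizer_iff]; exact sup_le (le_centralizer_iff.1 h) hC

theorem card_relIndex {G : Type*} [Group G] {A B : Subgroup G} (h : A ≤ B) :
    Nat.card A * A.relIndex B = Nat.card B := by
  rw [← relIndex_bot_left, ← relIndex_bot_left]
  exact relIndex_mul_relIndex _ _ _ bot_le h

theorem replacement {q : ℕ} [hq : Fact q.Prime] {G : Type*} [Group G] [Finite G]
    {P V B : Subgroup G} (hP : IsPGroup q P) [hVn : V.Normal] (hVP : V ≤ P)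
    (hV : V ≤ centralizer (V : Set G)) (hB : MaxAb P B) (hVB : ¬ V ≤ normalizer (B : Set G)) :
    ∃ B', MaxAb P B' ∧ Nat.card (B ⊓ V : Subgroup G) < Nat.card (B' ⊓ V : Subgroup G) ∧
      B' ≤ normalizer (B : Set G) := by
  obtain ⟨hBP, hBc, hBmax⟩ := hB
  set Y := (V ⊓ normalizer (B : Set G)) ⊔ B with hY
  have hYN : Y ≤ normalizer (B : Set G) := sup_le inf_le_right le_normalizer
  have hYVB : Y ≤ V ⊔ B := sup_le (inf_le_left.trans le_sup_left) le_sup_right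
  have hne : Y ≠ V ⊔ B := by
    intro h
    exact hVB ((le_sup_left (b := B)).trans (h ▸ hYN))
  have hVBp : IsPGroup q (V ⊔ B : Subgroup G) := hP.to_le (sup_le hVP hBP)
  obtain ⟨x, hx, hxY, hxN⟩ := growth hVBp hYVB hne
  obtain ⟨v, hv, b0, hb0, rfl⟩ := mem_sup_of_normal_left.1 hx
  have hBY : B ≤ Y := le_sup_right
  have hvN : v ∈ normalizer (Y : Set G) := by
    have : v = v * b0 * b0⁻¹ := by group
    rw [this]
    exact mul_mem hxN (inv_mem (le_normalizer (hBY hb0)))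
  have hvB : v ∉ normalizer (B : Set G) := by
    intro h
    exact hxY (Y.mul_mem (mem_sup_left ⟨hv, h⟩) (hBY hb0))
  let θ : G → G := fun b => v * b * v⁻¹ * b⁻¹
  have hθV : ∀ b, θ b ∈ V := by
    intro b
    have : θ b = v * (b * v⁻¹ * b⁻¹) := by simp only [θ]; group
    rw [this]
    exact V.mul_mem hv (hVn.conj_mem _ (V.inv_mem hv) b)
  have hθN : ∀ b ∈ B, θ b ∈ normalizer (B : Set G) := by
    intro b hb
    have h1 : v * b * v⁻¹ ∈ Y := (mem_normalizer_iff.1 hvN b).1 (hBY hb)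
    exact mul_mem (hYN h1) (inv_mem (le_normalizer hb))
  set M := closure (θ '' B) with hM
  have hMV : M ≤ V := by
    rw [hM, closure_le]; rintro _ ⟨b, hb, rfl⟩; exact hθV b
  have hMN : M ≤ normalizer (B : Set G) := by
    rw [hM, closure_le]; rintro _ ⟨b, hb, rfl⟩; exact hθN b hb
  have hθM : ∀ b ∈ B, θ b ∈ M := fun b hb => subset_closure ⟨b, hb, rfl⟩
  have hMM : M ≤ centralizer (M : Set G) :=
    hMV.trans (hV.trans (centralizer_le hMV))
  set C := B ⊓ centralizer (M : Set G) with hC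
  have hCB : C ≤ B := inf_le_left
  -- the key injectivity
  have key : ∀ b ∈ B, ∀ b' ∈ B, (θ b)⁻¹ * θ b' ∈ B → b⁻¹ * b' ∈ C := by
    intro b hb b' hb' h
    set c := b⁻¹ * b' with hc
    have hcB : c ∈ B := B.mul_mem (B.inv_mem hb) hb'
    refine ⟨hcB, ?_⟩
    have h1 : v * c * v⁻¹ ∈ B := by
      have : v * c * v⁻¹ = b⁻¹ * ((θ b)⁻¹ * θ b') * b' := by simp only [θ, hc]; group
      rw [this]
      exact B.mul_mem (B.mul_mem (B.inv_mem hb) h) hb'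
    have hz : θ c * v = v * θ c := (mem_centralizer_iff.1 (hV hv) (θ c) (hθV c))
    have h2 : v⁻¹ * c * v ∈ B := by
      have hzB : θ c ∈ B := B.mul_mem h1 (B.inv_mem hcB)
      have e : v⁻¹ * c * v = (θ c)⁻¹ * c := by
        have e1 : v⁻¹ * θ c * v = θ c := by rw [mul_assoc, hz]; group
        have e2 : v⁻¹ * θ c * v = c * (v⁻¹ * c * v)⁻¹ := by simp only [θ]; group
        rw [e1] at e2
        rw [e2]; group
      rw [e]
      exact B.mul_mem (B.inv_mem hzB) hcB
    have hcM : M ≤ centralizer {c} := by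
      rw [hM, closure_le]
      rintro _ ⟨d, hd, rfl⟩
      rw [SetLike.mem_coe, mem_centralizer_singleton_iff]
      have e1 : d * (v⁻¹ * c * v) = (v⁻¹ * c * v) * d := (mem_centralizer_iff.1 (hBc h2) d hd)
      have e2 : d * c = c * d := (mem_centralizer_iff.1 (hBc hcB) d hd)
      have e3 : d⁻¹ * c = c * d⁻¹ := (mem_centralizer_iff.1 (hBc hcB) d⁻¹ (B.inv_mem hd))
      change v * d * v⁻¹ * d⁻¹ * c = c * (v * d * v⁻¹ * d⁻¹)
      calc v * d * v⁻¹ * d⁻¹ * c = v * d * v⁻¹ * (d⁻¹ * c) := by group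
        _ = v * (d * (v⁻¹ * c * v)) * v⁻¹ * d⁻¹ := by rw [e3]; group
        _ = _ := by rw [e1]; group
    change c ∈ centralizer (M : Set G)
    rw [mem_centralizer_iff]
    intro m hm
    exact mem_centralizer_singleton_iff.1 (hcM hm)
  have hcount : C.relIndex B ≤ B.relIndex M := by
    change Nat.card (B ⧸ C.subgroupOf B) ≤ Nat.card (M ⧸ B.subgroupOf M)
    let f : B ⧸ C.subgroupOf B → M ⧸ B.subgroupOf M := fun z =>
      QuotientGroup.mk (⟨θ (z.out : B), hθM _ z.out.2⟩ : M)
    apply Nat.card_le_card_of_injective f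
    intro z z' hzz
    have h1 := QuotientGroup.eq.1 hzz
    rw [mem_subgroupOf] at h1
    have h2 := key _ z.out.2 _ z'.out.2 h1
    rw [← QuotientGroup.out_eq' z, ← QuotientGroup.out_eq' z', QuotientGroup.eq]
    exact mem_subgroupOf.2 h2
  have hCc : C ≤ centralizer (C : Set G) := hCB.trans (hBc.trans (centralizer_le hCB))
  have hCM : C ≤ centralizer (M : Set G) := inf_le_right
  have hMCB : M ⊓ C = M ⊓ B := by
    apply le_antisymm (inf_le_inf_left _ hCB)
    intro m hm
    exact ⟨hm.1, hm.2, hMM hm.1⟩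
  have hcard : Nat.card B ≤ Nat.card (M ⊔ C : Subgroup G) := by
    have h1 : B.relIndex M = C.relIndex M := by
      rw [← inf_relIndex_left M B, ← hMCB, inf_relIndex_left]
    have h2 : C.relIndex M ≤ C.relIndex (M ⊔ C) :=
      relIndex_le_of_le_right le_sup_left (by exact index_ne_zero_of_finite)
    rw [← card_relIndex hCB, ← card_relIndex (le_sup_right : C ≤ M ⊔ C)]
    exact Nat.mul_le_mul_left _ (hcount.trans (h1 ▸ h2))
  refine ⟨M ⊔ C, ⟨sup_le (hMV.trans hVP) (hCB.trans hBP), sup_ab hMM hCc hCM, ?_⟩, ?_, ?_⟩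
  · intro A hA hAc
    exact (hBmax A hA hAc).trans hcard
  · have hle : B ⊓ V ≤ (M ⊔ C) ⊓ V := by
      intro y hy
      refine ⟨mem_sup_right ⟨hy.1, ?_⟩, hy.2⟩
      exact centralizer_le hMV (hV hy.2)
    by_contra hcon
    have heq : B ⊓ V = (M ⊔ C) ⊓ V := eq_of_le_of_card_ge hle (not_lt.1 hcon)
    apply hvB
    apply mem_normalizer_of_conj
    intro b hb
    have h1 : θ b ∈ B ⊓ V := by
      rw [heq]; exact ⟨mem_sup_left (hθM b hb), hθV b⟩
    have : v * b * v⁻¹ = θ b * b := by simp only [θ]; group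
    rw [this]
    exact B.mul_mem h1.1 hb
  · exact sup_le hMN (hCB.trans le_normalizer)

theorem exists_MaxAb {G : Type*} [Group G] [Finite G] (P : Subgroup G) : ∃ A, MaxAb P A := by
  obtain ⟨A, ⟨h1, h2⟩, h3⟩ := Set.exists_max_image
    {A : Subgroup G | A ≤ P ∧ A ≤ centralizer (A : Set G)}
    (fun H => Nat.card H) (Set.toFinite _) ⟨⊥, bot_le, bot_le⟩
  exact ⟨A, h1, h2, fun B hB hBc => h3 B ⟨hB, hBc⟩⟩

theorem map_ab {G H : Type*} [Group G] [Group H] (f : G →* H) {A : Subgroup G}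
    (h : A ≤ centralizer (A : Set G)) : A.map f ≤ centralizer ((A.map f : Subgroup H) : Set H) := by
  rintro _ ⟨a, ha, rfl⟩
  rw [mem_centralizer_iff]
  rintro _ ⟨b, hb, rfl⟩
  rw [← map_mul, ← map_mul, mem_centralizer_iff.1 (h ha) b hb]

theorem comap_ab {G H : Type*} [Group G] [Group H] {f : G →* H} (hf : Function.Injective f)
    {A : Subgroup H}
    (h : A ≤ centralizer (A : Set H)) :
    A.comap f ≤ centralizer ((A.comap f : Subgroup G) : Set G) := by
  intro a ha
  rw [mem_centralizer_iff]
  intro b hb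
  apply hf
  rw [map_mul, map_mul, mem_centralizer_iff.1 (h ha) _ hb]

/-- the Thompson subgroup -/
def J {G : Type*} [Group G] (P : Subgroup G) : Subgroup P :=
  sSup {A : Subgroup P | MaxAb P (A.map P.subtype)}

theorem MaxAb.of_card {G : Type*} [Group G] {P A A' : Subgroup G} (h : MaxAb P A)
    (h1 : A' ≤ P) (h2 : A' ≤ centralizer (A' : Set G)) (h3 : Nat.card A = Nat.card A') :
    MaxAb P A' := ⟨h1, h2, fun B hB hBc => h3 ▸ h.2.2 B hB hBc⟩

theorem J_char {G : Type*} [Group G] (P : Subgroup G) : (J P).Characteristic := by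
  rw [characteristic_iff_map_le]
  intro φ
  rw [map_le_iff_le_comap]
  refine sSup_le ?_
  intro A hA
  rw [← map_le_iff_le_comap]
  refine le_sSup ?_
  have h1 : A ≤ centralizer (A : Set P) := by
    have := comap_ab P.subtype_injective hA.2.1
    rwa [comap_map_eq_self_of_injective P.subtype_injective] at this
  refine MaxAb.of_card hA (map_subtype_le _) (map_ab _ (map_ab _ h1)) ?_
  rw [card_map_of_injective P.subtype_injective, card_map_of_injective P.subtype_injective,
    card_map_of_injective φ.injective]

theorem J_ne_bot {G : Type*} [Group G] [Finite G] (P : Subgroup G) (hP : P ≠ ⊥) : J P ≠ ⊥ := by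
  intro h
  obtain ⟨A, hA⟩ := exists_MaxAb P
  have hAm : (A.subgroupOf P).map P.subtype = A := by
    rw [subgroupOf_map_subtype, inf_eq_left.2 hA.1]
  have h1 : A.subgroupOf P ≤ J P := le_sSup (by change MaxAb _ _; rw [hAm]; exact hA)
  rw [h, le_bot_iff] at h1
  rw [h1, Subgroup.map_bot] at hAm
  obtain ⟨x, hx1⟩ := ne_bot_iff_exists_ne_one.1 hP
  have hx := x.2
  have h2 := hA.2.2 (zpowers (x : G)) (by rw [zpowers_le]; exact hx) (by
    rintro _ ⟨a, rfl⟩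
    rw [mem_centralizer_iff]
    rintro _ ⟨b, rfl⟩
    exact (Commute.refl (x : G)).zpow_zpow b a)
  rw [← hAm] at h2
  have h3 : zpowers (x : G) = ⊥ := by
    apply eq_bot_of_card_le
    simpa using h2
  rw [zpowers_eq_bot] at h3
  exact hx1 (Subtype.ext h3)

theorem J_normal {G : Type*} [Group G] [Finite G] {P H : Subgroup G} (hH : H.Normal) (hHP : H ≤ P)
    (h : ∀ A, MaxAb P A → A ≤ H) : normalizer (((J P).map P.subtype : Subgroup G) : Set G) = ⊤ := by
  rw [eq_top_iff]
  intro g _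
  apply mem_normalizer_of_conj
  suffices hs : (J P) ≤ (((J P).map P.subtype).comap (MulAut.conj g).toMonoidHom).comap P.subtype by
    rintro _ ⟨x, hx, rfl⟩
    have := hs hx
    exact this
  refine sSup_le ?_
  intro A hA a ha
  set A2 := (A.map P.subtype).map (MulAut.conj g).toMonoidHom with hA2
  have hA2H : A2 ≤ H := by
    rintro _ ⟨x, hx, rfl⟩
    have := hH.conj_mem _ (h _ hA hx) g
    simpa using this
  have h2 : MaxAb P A2 := MaxAb.of_card hA (hA2H.trans hHP) (map_ab _ hA.2.1)
    (card_map_of_injective (MulAut.conj g).injective).symm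
  have hAm : (A2.subgroupOf P).map P.subtype = A2 := by
    rw [subgroupOf_map_subtype, inf_eq_left.2 h2.1]
  have h3 : A2.subgroupOf P ≤ J P := le_sSup (by change MaxAb _ _; rw [hAm]; exact h2)
  have h4 := map_mono (f := P.subtype) h3
  rw [hAm] at h4
  exact h4 ⟨a, ⟨a, ha, rfl⟩, rfl⟩

end Th

namespace Th
open Subgroup

/-- elements of order dividing `q` of the center of `H` -/
def om (q : ℕ) {G : Type*} [Group G] (H : Subgroup G) : Subgroup G where
  carrier := {z | z ∈ H ∧ (∀ h ∈ H, h * z = z * h) ∧ z ^ q = 1}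
  one_mem' := ⟨H.one_mem, by simp, by simp⟩
  mul_mem' := by
    rintro a b ⟨ha, ha2, ha3⟩ ⟨hb, hb2, hb3⟩
    refine ⟨H.mul_mem ha hb, fun h hh => ?_, ?_⟩
    · rw [← mul_assoc, ha2 h hh, mul_assoc, hb2 h hh, mul_assoc]
    · have hc : Commute a b := hb2 a ha
      rw [hc.mul_pow, ha3, hb3, one_mul]
  inv_mem' := by
    rintro a ⟨ha, ha2, ha3⟩
    refine ⟨H.inv_mem ha, fun h hh => ?_, by rw [inv_pow, ha3, inv_one]⟩
    have hc : Commute h a := ha2 h hh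
    exact hc.inv_right

theorem mem_om {q : ℕ} {G : Type*} [Group G] {H : Subgroup G} {z : G} :
    z ∈ om q H ↔ z ∈ H ∧ (∀ h ∈ H, h * z = z * h) ∧ z ^ q = 1 := Iff.rfl

theorem om_normal (q : ℕ) {G : Type*} [Group G] {H : Subgroup G} (hH : H.Normal) :
    (om q H).Normal := by
  constructor
  rintro z ⟨h1, h2, h3⟩ g
  refine ⟨hH.conj_mem _ h1 g, fun h hh => ?_, ?_⟩
  · have := h2 (g⁻¹ * h * g) (by simpa using hH.conj_mem _ hh g⁻¹)
    calc h * (g * z * g⁻¹) = g * ((g⁻¹ * h * g) * z) * g⁻¹ := by group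
      _ = _ := by rw [this]; group
  · rw [conj_pow, h3]; simp

theorem om_char (q : ℕ) {G : Type*} [Group G] : (om q (⊤ : Subgroup G)).Characteristic := by
  rw [characteristic_iff_map_le]
  rintro φ _ ⟨z, ⟨h1, h2, h3⟩, rfl⟩
  refine ⟨trivial, fun h _ => ?_, ?_⟩
  · obtain ⟨h, rfl⟩ := φ.surjective h
    have := congrArg φ (h2 h trivial)
    simpa using this
  · have := congrArg φ h3
    simpa using this

theorem om_map (q : ℕ) {G : Type*} [Group G] (P : Subgroup G) :
    (om q (⊤ : Subgroup P)).map P.subtype = om q P := by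
  ext z
  constructor
  · rintro ⟨z, ⟨_, h2, h3⟩, rfl⟩
    refine ⟨z.2, fun h hh => ?_, ?_⟩
    · exact congrArg Subtype.val (h2 ⟨h, hh⟩ trivial)
    · exact congrArg Subtype.val h3
  · rintro ⟨h1, h2, h3⟩
    exact ⟨⟨z, h1⟩, ⟨trivial, fun h _ => Subtype.ext (h2 h h.2), Subtype.ext h3⟩, rfl⟩

theorem om_ne_bot {q : ℕ} [hq : Fact q.Prime] {G : Type*} [Group G] [Finite G] [Nontrivial G]
    (hG : IsPGroup q G) : om q (⊤ : Subgroup G) ≠ ⊥ := by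
  have hc := hG.center_nontrivial
  obtain ⟨n, hn⟩ := IsPGroup.iff_card.1 (hG.to_subgroup (center G))
  have hn0 : n ≠ 0 := by
    rintro rfl
    rw [pow_zero] at hn
    exact (nontrivial_iff_ne_bot _).1 hc (eq_bot_of_card_eq _ hn)
  obtain ⟨z, hz⟩ := exists_prime_orderOf_dvd_card' (G := center G) q (hn ▸ dvd_pow_self q hn0)
  intro h
  have hz2 : (z : G) ∈ om q (⊤ : Subgroup G) := by
    refine ⟨trivial, fun h _ => mem_center_iff.1 z.2 h, ?_⟩
    have : z ^ q = 1 := hz ▸ pow_orderOf_eq_one z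
    exact congrArg Subtype.val this
  rw [h, mem_bot] at hz2
  have : z = 1 := Subtype.ext hz2
  rw [this, orderOf_one] at hz
  exact hq.out.one_lt.ne hz

structure Cfg (q : ℕ) {G : Type*} [Group G] (P H K : Subgroup G) : Prop where
  hP : IsPGroup q P
  hHP : H ≤ P
  hHn : H.Normal
  hKn : K.Normal
  hHK : H ≤ K
  hHp : IsPGroup q H
  hHb : H ≠ ⊥
  hmax : ∀ U : Subgroup G, U.Normal → IsPGroup q U → U ≤ H
  kpow : ∃ k, K.index = q ^ k
  hcop : (H.relIndex K).Coprime q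
  hCK : centralizer (H : Set G) ⊓ K ≤ H
  hmin : ∀ X : Subgroup G, H ≤ X → X ≤ K → P ≤ normalizer (X : Set G) → X = H ∨ X = K
  hPK : P ⊔ K = ⊤
  hab : ∀ x ∈ K, ∀ y ∈ K, x * y * x⁻¹ * y⁻¹ ∈ H
  hyp : Hyp q P
  hnot : ¬ QNil q G

theorem isPGroup_of_elts {q : ℕ} [hq : Fact q.Prime] {G : Type*} [Group G] [Finite G]
    {T : Subgroup G} (h : ∀ t ∈ T, (orderOf t).Coprime q → t = 1) : IsPGroup q T := by
  intro t
  obtain ⟨a, m, hm, ho⟩ := Nat.exists_eq_pow_mul_and_not_dvd (orderOf_pos (t : G)).ne' q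
    hq.out.ne_one
  refine ⟨a, Subtype.ext ?_⟩
  apply h _ (T.pow_mem t.2 _)
  have h2 : orderOf ((t : G) ^ q ^ a) = m := by
    rw [orderOf_pow_of_dvd (pow_ne_zero _ hq.out.ne_zero) (ho ▸ dvd_mul_right _ _), ho,
      Nat.mul_div_cancel_left _ (pow_pos hq.out.pos a)]
  rw [h2]
  exact Nat.coprime_comm.1 ((Nat.Prime.coprime_iff_not_dvd hq.out).2 hm)

section
variable {q : ℕ} [hq : Fact q.Prime] {G : Type*} [Group G] [Finite G] {P H K : Subgroup G}

theorem Cfg.le_H (c : Cfg q P H K) {T : Subgroup G} (hT : T.Normal) (h : T ⊓ K ≤ H) : T ≤ H := by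
  apply c.hmax T hT
  apply isPGroup_of_elts
  intro t ht ho
  obtain ⟨k, hk⟩ := c.kpow
  exact eq_one_of_coprime c.hHp (h ⟨ht, mem_of_coprime c.hKn hk ho⟩) ho

theorem Cfg.cent (c : Cfg q P H K) : centralizer (H : Set G) ≤ H := by
  have := c.hHn
  exact c.le_H inferInstance c.hCK

theorem Cfg.not_normalizer_top (c : Cfg q P H K) (W : Subgroup P) (hW : W.Characteristic)
    (hne : W ≠ ⊥) (h : normalizer ((W.map P.subtype : Subgroup G) : Set G) = ⊤) : False := by
  have h1 := c.hyp W hW hne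
  rw [h] at h1
  exact c.hnot (h1.of_surjective (⊤ : Subgroup G).subtype (fun x => ⟨⟨x, trivial⟩, rfl⟩))

theorem Cfg.centV (c : Cfg q P H K) : centralizer ((om q H : Subgroup G) : Set G) ≤ H := by
  have hHn := c.hHn
  have hKn := c.hKn
  have hVn := om_normal q c.hHn
  set D := centralizer ((om q H : Subgroup G) : Set G) with hD
  have hDn : D.Normal := inferInstance
  have hHD : H ≤ D := by
    intro h hh
    rw [hD, mem_centralizer_iff]
    intro v hv
    exact (hv.2.1 h hh).symm
  rcases c.hmin (D ⊓ K) (le_inf hHD c.hHK) inf_le_right (by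
    rw [normalizer_eq_top_iff.2 inferInstance]; exact le_top) with h | h
  · exact c.le_H hDn h.le
  · exfalso
    have hKD : K ≤ D := by rw [← h]; exact inf_le_left
    have hPnt : Nontrivial P := by
      rw [nontrivial_iff_ne_bot]
      intro hb
      exact c.hHb (le_bot_iff.1 (hb ▸ c.hHP))
    apply c.not_normalizer_top (om q (⊤ : Subgroup P)) (om_char q) (om_ne_bot c.hP)
    rw [om_map]
    have hWV : om q P ≤ om q H := by
      rintro z ⟨h1, h2, h3⟩
      refine ⟨c.cent ?_, fun h hh => h2 h (c.hHP hh), h3⟩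
      rw [mem_centralizer_iff]
      intro h hh
      exact h2 h (c.hHP hh)
    have hcen : ∀ g : G, g ∈ centralizer ((om q P : Subgroup G) : Set G) := by
      intro g
      have hg : g ∈ P ⊔ K := by rw [c.hPK]; trivial
      revert g
      change P ⊔ K ≤ _
      refine sup_le ?_ (hKD.trans (centralizer_le hWV))
      intro x hx
      rw [mem_centralizer_iff]
      intro z hz
      exact (hz.2.1 x hx).symm
    rw [eq_top_iff]
    intro g _
    apply mem_normalizer_of_conj
    intro u hu
    have := mem_centralizer_iff.1 (hcen g) u hu
    rw [← this, mul_inv_cancel_right]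
    exact hu

end

/-- action on a normal subgroup -/
def rho {G : Type*} [Group G] (V : Subgroup G) [hV : V.Normal] :
    G →* AddMonoid.End (Additive V) where
  toFun g := MonoidHom.toAdditive (MulAut.conjNormal (H := V) g).toMonoidHom
  map_one' := by rw [map_one]; rfl
  map_mul' a b := by rw [map_mul]; rfl

theorem rho_apply {G : Type*} [Group G] (V : Subgroup G) [hV : V.Normal] (g : G) (v : V) :
    (((rho V g (Additive.ofMul v)).toMul : V) : G) = g * v * g⁻¹ := rfl

theorem rho_ext {G : Type*} [Group G] {V : Subgroup G} [hV : V.Normal] {a b : G} :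
    rho V a = rho V b ↔ ∀ v ∈ V, a * v * a⁻¹ = b * v * b⁻¹ := by
  constructor
  · intro h v hv
    rw [← rho_apply V a ⟨v, hv⟩, h, rho_apply]
  · intro h
    refine AddMonoidHom.ext fun v => ?_
    exact congrArg Additive.ofMul (Subtype.ext (h _ v.toMul.2))

open scoped IsMulCommutative in
theorem rho_key {q : ℕ} [hq : Fact q.Prime] (hq2 : q ≠ 2) {G : Type*} [Group G]
    (V K : Subgroup G) [hV : V.Normal] [hK : K.Normal] (hc : V ≤ centralizer (V : Set G))
    (hVq : ∀ v ∈ V, v ^ q = 1) (hKc : ∀ x ∈ K, ∀ y ∈ K, rho V (x * y) = rho V (y * x))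
    (m : ℕ) (hm : m.Coprime q) (hfin : ∀ x ∈ K, rho V (x ^ m) = 1)
    (b : G) (hb : ∀ v ∈ V, b * (b * v * b⁻¹ * v⁻¹) * b⁻¹ = b * v * b⁻¹ * v⁻¹) :
    ∀ x ∈ K, rho V (b * x) = rho V (x * b) := by
  have : IsMulCommutative V := ⟨⟨fun x y => Subtype.ext (mem_centralizer_iff.1 (hc y.2) x x.2)⟩⟩
  have key := ring_key (R := AddMonoid.End (Additive V)) hq2 (b := rho V b) (b' := rho V b⁻¹)
    (S := rho V '' K) (m := m)
  intro x hx
  rw [map_mul, map_mul]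
  refine key ?_ ?_ ?_ ?_ ?_ hm ?_ ?_ _ ⟨x, hx, rfl⟩
  · refine AddMonoidHom.ext fun v => ?_
    refine Eq.trans (b := q • v) rfl ?_
    exact congrArg Additive.ofMul (Subtype.ext (hVq v.toMul v.toMul.2) : v.toMul ^ q = 1)
  · rw [← map_mul, mul_inv_cancel, map_one]
  · refine AddMonoidHom.ext fun v => ?_
    have h1 : ∀ w : Additive V, (rho V b - 1) w = rho V b w - w := fun w => rfl
    change (rho V b - 1) ((rho V b - 1) v) = 0
    rw [h1, sub_eq_zero, h1]
    apply Additive.toMul.injective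
    apply Subtype.ext
    have := hb v.toMul v.toMul.2
    have h2 : ∀ w : Additive V, ((rho V b w).toMul : G) = b * w.toMul * b⁻¹ := fun w => rfl
    have h3 : ((rho V b (rho V b v - v)).toMul : G) =
        b * ((rho V b v).toMul * (v.toMul : G)⁻¹) * b⁻¹ := by
      rw [h2, toMul_sub, div_eq_mul_inv]; rfl
    rw [h3, h2, toMul_sub, div_eq_mul_inv]
    exact this.trans (by rw [← h2]; rfl)
  · rintro _ ⟨x, hx, rfl⟩ _ ⟨y, hy, rfl⟩
    exact ⟨x * y, K.mul_mem hx hy, map_mul _ _ _⟩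
  · rintro _ ⟨x, hx, rfl⟩ _ ⟨y, hy, rfl⟩
    rw [← map_mul, ← map_mul, hKc x hx y hy]
  · rintro _ ⟨x, hx, rfl⟩
    rw [← map_pow, hfin x hx]
  · rintro _ ⟨x, hx, rfl⟩
    exact ⟨b * x * b⁻¹, hK.conj_mem _ hx b, by rw [map_mul, map_mul]⟩

theorem Cfg.contra {q : ℕ} [hq : Fact q.Prime] (hq2 : q ≠ 2) {G : Type*} [Group G] [Finite G]
    {P H K : Subgroup G} (c : Cfg q P H K) : False := by
  have hHn := c.hHn
  have hKn := c.hKn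
  have hVn := om_normal q c.hHn
  have hCV := c.centV
  set V := om q H with hVdef
  have hVH : V ≤ H := fun v hv => hv.1
  have hHV : H ≤ centralizer (V : Set G) := by
    intro h hh
    rw [mem_centralizer_iff]
    intro v hv
    exact (hv.2.1 h hh).symm
  have hVc : V ≤ centralizer (V : Set G) := hVH.trans hHV
  have hVP : V ≤ P := hVH.trans c.hHP
  have hex : ∃ A, MaxAb P A ∧ ¬ A ≤ H := by
    by_contra hcon
    push Not at hcon
    refine c.not_normalizer_top (J P) (J_char P) (J_ne_bot P ?_) (J_normal hHn c.hHP hcon)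
    intro hb
    exact c.hHb (le_bot_iff.1 (hb ▸ c.hHP))
  obtain ⟨B, ⟨hB, hBH⟩, hBmax⟩ := Set.exists_max_image {A : Subgroup G | MaxAb P A ∧ ¬ A ≤ H}
    (fun A => Nat.card (A ⊓ V : Subgroup G)) (Set.toFinite _) hex
  have hVB : V ≤ normalizer (B : Set G) := by
    by_contra hcon
    obtain ⟨B', hB', hlt, hN⟩ := replacement c.hP hVP hVc hB hcon
    by_cases hB'H : B' ≤ H
    · have h1 : B' ⊔ V ≤ centralizer ((B' ⊔ V : Subgroup G) : Set G) :=
        sup_ab hB'.2.1 hVc (le_centralizer_iff.1 (hB'H.trans hHV))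
      have h2 := hB'.2.2 _ (sup_le hB'.1 hVP) h1
      have h3 : B' = B' ⊔ V := eq_of_le_of_card_ge le_sup_left h2
      exact hcon ((h3 ▸ le_sup_right : V ≤ B').trans hN)
    · exact absurd (hBmax B' ⟨hB', hB'H⟩) (not_le.2 hlt)
  obtain ⟨b, hbB, hbH⟩ := SetLike.not_le_iff_exists.1 hBH
  have hH1 : ∀ {a b : G}, a * b⁻¹ ∈ H → rho V a = rho V b := by
    intro a b hab
    rw [rho_ext]
    intro v hv
    have h1 := mem_centralizer_iff.1 (hHV hab) (b * v * b⁻¹) (hVn.conj_mem v hv b)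
    calc a * v * a⁻¹ = ((a * b⁻¹) * (b * v * b⁻¹)) * (a * b⁻¹)⁻¹ := by group
      _ = _ := by rw [← h1]; group
  have hbK := rho_key hq2 V K hVc (fun v hv => hv.2.2)
    (fun x hx y hy => hH1 (by
      have := c.hab x hx y hy
      simpa [mul_assoc] using this))
    (H.relIndex K) c.hcop
    (fun x hx => by
      rw [← map_one (rho V)]
      apply hH1
      rw [inv_one, mul_one]
      have : (⟨x, hx⟩ : K) ^ (H.subgroupOf K).index ∈ H.subgroupOf K := pow_index_mem _ _
      exact this)
    b (fun v hv => by
      have h1 : b * v * b⁻¹ * v⁻¹ ∈ B := by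
        have h2 := (mem_normalizer_iff.1 (hVB hv) b⁻¹).1 (B.inv_mem hbB)
        have : b * v * b⁻¹ * v⁻¹ = b * (v * b⁻¹ * v⁻¹) := by group
        rw [this]; exact B.mul_mem hbB h2
      have h2 := mem_centralizer_iff.1 (hB.2.1 h1) b hbB
      rw [h2, mul_inv_cancel_right])
  have hbK2 : ∀ x ∈ K, x * b * x⁻¹ * b⁻¹ ∈ H := by
    intro x hx
    apply hCV
    rw [mem_centralizer_iff]
    intro v hv
    have h1 := rho_ext.1 (hbK x hx) ((x * b)⁻¹ * v * (x * b))
      (by simpa using hVn.conj_mem v hv (x * b)⁻¹)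
    have h2 := rho_ext.1 (hbK x⁻¹ (K.inv_mem hx))
    have h3 : b * x * (x * b)⁻¹ * v = v * (b * x * (x * b)⁻¹) := by
      calc _ = (b * x * ((x * b)⁻¹ * v * (x * b)) * (b * x)⁻¹) * (b * x * (x * b)⁻¹) := by group
        _ = _ := by rw [h1]; group
    calc v * (x * b * x⁻¹ * b⁻¹) = (b * x * (x * b)⁻¹)⁻¹ * ((b * x * (x * b)⁻¹) * v) * (b * x * (x * b)⁻¹)⁻¹ := by group
      _ = _ := by rw [h3]; group
  -- the elements of `P` centralizing `K` modulo `H`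
  set C := (centralizer ((K.map (QuotientGroup.mk' H) : Subgroup (G ⧸ H)) : Set (G ⧸ H))).comap
    (QuotientGroup.mk' H) with hC
  have hKm : (K.map (QuotientGroup.mk' H)).Normal :=
    hKn.map _ (QuotientGroup.mk'_surjective H)
  have hCn : C.Normal := Normal.comap inferInstance _
  have hCmem : ∀ t, t ∈ C ↔ ∀ x ∈ K, x * t * x⁻¹ * t⁻¹ ∈ H := by
    intro t
    rw [hC, mem_comap, mem_centralizer_iff]
    constructor
    · intro h x hx
      have := h _ ⟨x, hx, rfl⟩
      rw [← QuotientGroup.eq_one_iff]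
      change QuotientGroup.mk' H (x * t * x⁻¹ * t⁻¹) = 1
      rw [map_mul, map_mul, map_mul, this]; simp
    · rintro h _ ⟨x, hx, rfl⟩
      have := (QuotientGroup.eq_one_iff _).2 (h x hx)
      change QuotientGroup.mk' H (x * t * x⁻¹ * t⁻¹) = 1 at this
      rw [map_mul, map_mul, map_mul, map_inv, map_inv, mul_inv_eq_one, mul_inv_eq_iff_eq_mul] at this
      exact this
  have hQn : (C ⊓ P).Normal := by
    rw [← normalizer_eq_top_iff, eq_top_iff, ← c.hPK]
    refine sup_le ?_ ?_
    · intro x hx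
      apply mem_normalizer_of_conj
      intro t ht
      exact ⟨hCn.conj_mem t ht.1 x, P.mul_mem (P.mul_mem hx ht.2) (P.inv_mem hx)⟩
    · intro x hx
      apply mem_normalizer_of_conj
      intro t ht
      refine ⟨hCn.conj_mem t ht.1 x, ?_⟩
      have h1 := (hCmem t).1 ht.1 x hx
      have : x * t * x⁻¹ = (x * t * x⁻¹ * t⁻¹) * t := by group
      rw [this]
      exact P.mul_mem (c.hHP h1) ht.2
  exact hbH (c.hmax _ hQn (c.hP.to_le inf_le_right) ⟨(hCmem b).2 hbK2, hB.1 hbB⟩)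

end Th

namespace Th
open Subgroup

theorem thompson_odd {q : ℕ} [hq : Fact q.Prime] (hq2 : q ≠ 2) : ∀ (n : ℕ) {G : Type*} [Group G]
    [Finite G], Nat.card G ≤ n → ∀ P : Sylow q G, Hyp q (P : Subgroup G) → QNil q G := by
  intro n
  induction n with
  | zero =>
    intro G _ _ hc
    exact absurd hc (by have := Nat.card_pos (α := G); omega)
  | succ n ihn =>
    intro G _ _ hc P hP
    by_contra hn
    have ih : ∀ L : Subgroup G, L ≠ ⊤ → ∀ S : Sylow q L, Hyp q (S : Subgroup L) → QNil q L := by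
      intro L hL S hS
      exact ihn (by have := card_lt_of_ne_top hL; omega) S hS
    have ihq : ∀ (O : Subgroup G) [O.Normal], O ≠ ⊥ →
        ∀ S : Sylow q (G ⧸ O), Hyp q (S : Subgroup (G ⧸ O)) → QNil q (G ⧸ O) := by
      intro O _ hO S hS
      refine ihn ?_ S hS
      have h1 := O.card_eq_card_quotient_mul_card_subgroup
      have h2 : 1 < Nat.card O := (one_lt_card_iff_ne_bot O).2 hO
      have h3 : 0 < Nat.card (G ⧸ O) := Nat.card_pos
      have h4 : Nat.card (G ⧸ O) * 2 ≤ Nat.card G := by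
        rw [h1]; exact Nat.mul_le_mul_left _ h2
      omega
    obtain ⟨U, hUb, hUp, hUn⟩ := step_a ih P hP hn
    obtain ⟨H, hHn, hHp, hmax⟩ := exists_core q G
    have hHb : H ≠ ⊥ := by
      rintro rfl
      exact hUb (le_bot_iff.1 (hmax U hUn hUp))
    have hb : ∀ (P : Sylow q G) (L : Subgroup G), L ≠ ⊤ → (P : Subgroup G) ≤ L → QNil q L := by
      intro Q L hL hQL
      exact step_b ih Q (Hyp.conj P Q hP) L hL hQL
    obtain ⟨Kb, hKbn, hKbc, k, hk⟩ := step_c hb P H hHp hmax (ihq H hHb)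
    have hO : ∀ O : Subgroup G, O.Normal → (Nat.card O).Coprime q → O = ⊥ := by
      intro O hOn hOc
      by_contra hOb
      exact hn (QNil.of_quot O hOc (step_d P hP O hOc (ihq O hOb)))
    set K := Kb.comap (QuotientGroup.mk' H) with hK
    have hs := QuotientGroup.mk'_surjective H
    have hKn : K.Normal := hKbn.comap _
    have hHK : H ≤ K := by
      intro h hh
      rw [hK, mem_comap, QuotientGroup.mk'_apply, (QuotientGroup.eq_one_iff h).2 hh]
      exact Kb.one_mem
    have hKi : K.index = q ^ k := by
      rw [hK, index_comap_of_surjective _ hs, hk]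
    have hKm : K.map (QuotientGroup.mk' H) = Kb := map_comap_eq_self_of_surjective hs Kb
    have hcop : (H.relIndex K).Coprime q := by
      have : H.relIndex K = Nat.card Kb := by
        conv_lhs => rw [← QuotientGroup.ker_mk' H, relIndex_ker, hKm]
      rw [this]; exact hKbc
    have hCK := step_e H K hHp hmax hO hcop
    have hmin : ∀ X : Subgroup G, H ≤ X → X ≤ K → (P : Subgroup G) ≤ normalizer (X : Set G) →
        X = H ∨ X = K :=
      step_f (P : Subgroup G) P.isPGroup' (hb P) H K hHp hKi hcop hCK
    have hPK : (P : Subgroup G) ⊔ K = ⊤ := by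
      rw [sup_comm]; exact compl_sup_sylow hKi P
    have hab' := min_abelian Kb hKbc ((P : Subgroup G).map (QuotientGroup.mk' H))
      (P.isPGroup'.map _) (by
        intro X hX hPX
        have h1 := hmin (X.comap (QuotientGroup.mk' H)) (by
          intro h hh
          rw [mem_comap, QuotientGroup.mk'_apply, (QuotientGroup.eq_one_iff h).2 hh]
          exact X.one_mem) (comap_mono hX) (by
          intro x hx
          apply mem_normalizer_of_conj
          intro u hu
          have h2 := hPX (mem_map_of_mem (QuotientGroup.mk' H) hx)
          rw [mem_normalizer_iff] at h2
          have h3 := (h2 _).1 hu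
          rw [mem_comap, map_mul, map_mul, map_inv]
          exact h3)
        rw [← map_comap_eq_self_of_surjective hs X]
        rcases h1 with h1 | h1
        · left; rw [h1]
          exact (Subgroup.map_eq_bot_iff _).2 (by rw [QuotientGroup.ker_mk'])
        · right; rw [h1, hKm])
    have hab : ∀ x ∈ K, ∀ y ∈ K, x * y * x⁻¹ * y⁻¹ ∈ H := by
      intro x hx y hy
      have := hab' _ hx _ hy
      rw [← QuotientGroup.ker_mk' H, MonoidHom.mem_ker, map_mul, map_mul, map_mul, this, map_inv,
        map_inv]
      group
    clear_value K
    have c : Cfg q (P : Subgroup G) H K :=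
      { hP := P.isPGroup', hHP := normal_le_sylow hHn hHp P, hHn := hHn, hKn := hKn, hHK := hHK
        hHp := hHp, hHb := hHb, hmax := hmax, kpow := ⟨k, hKi⟩, hcop := hcop, hCK := hCK
        hmin := hmin, hPK := hPK, hab := hab, hyp := hP, hnot := hn }
    exact Cfg.contra hq2 c
end Th

namespace Th
open Subgroup

/-- a fixed-point-free endomorphism with `φ^p = 1` -/
structure FPF (p : ℕ) {G : Type*} [Group G] (φ : G →* G) : Prop where
  per : ∀ x, φ^[p] x = x
  fix : ∀ x, φ x = x → x = 1

/-- restriction of an endomorphism -/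
def res {G : Type*} [Group G] (φ : G →* G) (L : Subgroup G) (hL : ∀ x ∈ L, φ x ∈ L) : L →* L :=
  (φ.comp L.subtype).codRestrict L (fun x => hL x x.2)

theorem res_coe {G : Type*} [Group G] (φ : G →* G) (L : Subgroup G) (hL : ∀ x ∈ L, φ x ∈ L)
    (x : L) : (res φ L hL x : G) = φ x := rfl

theorem res_iter {G : Type*} [Group G] (φ : G →* G) (L : Subgroup G) (hL : ∀ x ∈ L, φ x ∈ L)
    (i : ℕ) (x : L) : ((res φ L hL)^[i] x : G) = φ^[i] x := by
  induction i with
  | zero => rfl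
  | succ i ih => rw [Function.iterate_succ_apply', Function.iterate_succ_apply', res_coe, ih]

theorem FPF.res {p : ℕ} {G : Type*} [Group G] {φ : G →* G} (h : FPF p φ) (L : Subgroup G)
    (hL : ∀ x ∈ L, φ x ∈ L) : FPF p (res φ L hL) where
  per x := Subtype.ext (by rw [res_iter, h.per])
  fix x hx := Subtype.ext (h.fix x (by rw [← res_coe φ L hL, hx]))

theorem FPF.inj {p : ℕ} (hp : p.Prime) {G : Type*} [Group G] {φ : G →* G} (h : FPF p φ) :
    Function.Injective φ := by
  intro x y hxy
  rw [← h.per x, ← h.per y, ← Nat.succ_pred_eq_of_pos hp.pos, Function.iterate_succ_apply,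
    Function.iterate_succ_apply, hxy]

theorem FPF.surj_div {p : ℕ} {G : Type*} [Group G] [Finite G] {φ : G →* G} (h : FPF p φ) (g : G) :
    ∃ a, a * (φ a)⁻¹ = g := by
  have h1 : Function.Injective (fun a => a * (φ a)⁻¹) := by
    intro a b hab
    have h2 : φ (b⁻¹ * a) = b⁻¹ * a := by
      rw [map_mul, map_inv]
      have hab' : a * (φ a)⁻¹ = b * (φ b)⁻¹ := hab
      calc (φ b)⁻¹ * φ a = b⁻¹ * (b * (φ b)⁻¹) * φ a := by group
        _ = _ := by rw [← hab']; group
    have := h.fix _ h2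
    exact (inv_mul_eq_one.1 this).symm
  exact (Finite.injective_iff_surjective.1 h1) g

theorem FPF.quot {p : ℕ} {G : Type*} [Group G] [Finite G] {φ : G →* G} (h : FPF p φ)
    (V : Subgroup G) [V.Normal] (hV : ∀ x ∈ V, φ x ∈ V) :
    FPF p (QuotientGroup.map V V φ hV) where
  per x := by
    induction x using QuotientGroup.induction_on with
    | H x =>
      have : ∀ i, (QuotientGroup.map V V φ hV)^[i] (x : G ⧸ V) = ((φ^[i] x : G) : G ⧸ V) := by
        intro i
        induction i with
        | zero => rfl
        | succ i ih =>
          rw [Function.iterate_succ_apply', Function.iterate_succ_apply', ih]; rfl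
      rw [this, h.per]
  fix x := by
    induction x using QuotientGroup.induction_on with
    | H x =>
      intro hx
      replace hx : ((φ x : G) : G ⧸ V) = (x : G ⧸ V) := hx
      have h1 : x * (φ x)⁻¹ ∈ V := by
        rw [← QuotientGroup.eq_one_iff, QuotientGroup.mk_mul, QuotientGroup.mk_inv, hx,
          mul_inv_cancel]
      obtain ⟨v, hv⟩ := (h.res V hV).surj_div ⟨_, h1⟩
      have hv' : (v : G) * (φ v)⁻¹ = x * (φ x)⁻¹ := congrArg Subtype.val hv
      have h2 : φ (x⁻¹ * v) = x⁻¹ * v := by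
        rw [map_mul, map_inv]
        calc (φ x)⁻¹ * φ v = x⁻¹ * (x * (φ x)⁻¹) * φ v := by group
          _ = _ := by rw [← hv']; group
      have := inv_mul_eq_one.1 (h.fix _ h2)
      rw [QuotientGroup.eq_one_iff, this]
      exact v.2

theorem FPF.iter {p : ℕ} (hp : p.Prime) {G : Type*} [Group G] {φ : G →* G} (h : FPF p φ)
    {i : ℕ} (h0 : 0 < i) (hi : i < p) (x : G) (hx : φ^[i] x = x) : x = 1 := by
  apply h.fix
  have h1 : Function.IsPeriodicPt φ i x := hx
  have h2 : Function.IsPeriodicPt φ p x := h.per x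
  have h3 := h1.gcd h2
  have : Nat.gcd i p = 1 := by
    rw [Nat.gcd_comm]; exact Nat.coprime_of_lt_prime h0.ne' hi hp
  rw [this] at h3
  exact h3

theorem fpf_key {p : ℕ} (hp : p.Prime) {V Q : Type*} [CommGroup V] [Group Q] [Finite Q]
    (a : Q →* MulAut V) {φ : V →* V} {ψ : Q →* Q} (hc : ∀ x v, φ (a x v) = a (ψ x) (φ v))
    (hφ : FPF p φ) (hψ : FPF p ψ) (hC : ∀ v, (∀ x, a x v = v) → v = 1) (v : V) :
    v ^ Nat.card Q = 1 := by
  have := Fintype.ofFinite Q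
  have hci : ∀ i x v, φ^[i] (a x v) = a (ψ^[i] x) (φ^[i] v) := by
    intro i
    induction i with
    | zero => intro x v; rfl
    | succ i ih =>
      intro x v
      rw [Function.iterate_succ_apply', ih, hc, Function.iterate_succ_apply',
        Function.iterate_succ_apply']
  have h1 : ∀ w : V, ∏ i ∈ Finset.range p, φ^[i] w = 1 := by
    intro w
    apply hφ.fix
    rw [map_prod]
    have e1 : ∏ i ∈ Finset.range p, φ (φ^[i] w) = ∏ i ∈ Finset.range p, φ^[i+1] w :=
      Finset.prod_congr rfl fun i _ => (Function.iterate_succ_apply' _ _ _).symm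
    have e2 := Finset.prod_range_succ (fun i => φ^[i] w) p
    have e3 := Finset.prod_range_succ' (fun i => φ^[i] w) p
    rw [e1]
    rw [e2] at e3
    simp only [hφ.per, Function.iterate_zero, id] at e3
    exact (mul_right_cancel e3).symm
  have h2 : ∀ x : Q, ∏ i ∈ Finset.range p, a (x * (ψ^[i] x)⁻¹) (φ^[i] v) = 1 := by
    intro x
    have e : ∀ i, a (x * (ψ^[i] x)⁻¹) (φ^[i] v) = a x (φ^[i] (a x⁻¹ v)) := by
      intro i
      rw [hci, map_mul, MulAut.mul_apply]
      congr 3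
      have : ∀ i, (ψ^[i] x)⁻¹ = ψ^[i] x⁻¹ := by
        intro i
        induction i with
        | zero => rfl
        | succ i ih => rw [Function.iterate_succ_apply', Function.iterate_succ_apply', ← ih, map_inv]
      exact this i
    rw [Finset.prod_congr rfl fun i _ => e i, ← map_prod, h1, map_one]
  have h3 : ∏ i ∈ Finset.range p, ∏ x : Q, a (x * (ψ^[i] x)⁻¹) (φ^[i] v) = 1 := by
    rw [Finset.prod_comm]
    exact Finset.prod_eq_one fun x _ => h2 x
  rw [Finset.prod_eq_single_of_mem 0 (Finset.mem_range.2 hp.pos)] at h3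
  · have h4 : ∏ x : Q, a (x * (ψ^[0] x)⁻¹) (φ^[0] v) = ∏ x : Q, v :=
      Finset.prod_congr rfl fun x _ => by
        rw [Function.iterate_zero, Function.iterate_zero, id, id, mul_inv_cancel, map_one]; rfl
    rw [h4, Finset.prod_const, Finset.card_univ, Fintype.card_eq_nat_card] at h3
    exact h3
  · intro i hi hi0
    have hinj : Function.Injective (fun x : Q => x * (ψ^[i] x)⁻¹) := by
      intro x y hxy
      have hxy' : x * (ψ^[i] x)⁻¹ = y * (ψ^[i] y)⁻¹ := hxy
      have hm : ∀ i (x y : Q), ψ^[i] (y⁻¹ * x) = (ψ^[i] y)⁻¹ * ψ^[i] x := by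
        intro i x y
        induction i with
        | zero => rfl
        | succ i ih => simp only [Function.iterate_succ_apply', ih, map_mul, map_inv]
      have h4 : ψ^[i] (y⁻¹ * x) = y⁻¹ * x := by
        rw [hm]
        calc (ψ^[i] y)⁻¹ * ψ^[i] x = y⁻¹ * (y * (ψ^[i] y)⁻¹) * ψ^[i] x := by group
          _ = _ := by rw [← hxy']; group
      exact (inv_mul_eq_one.1 (hψ.iter hp (Nat.pos_of_ne_zero hi0) (Finset.mem_range.1 hi) _ h4)).symm
    have hbij := Finite.injective_iff_bijective.1 hinj
    rw [hbij.prod_comp (fun y => a y (φ^[i] v))]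
    apply hC
    intro x
    rw [map_prod]
    have : ∀ y, a x (a y (φ^[i] v)) = a (x * y) (φ^[i] v) := fun y => by
      rw [map_mul, MulAut.mul_apply]
    rw [Finset.prod_congr rfl fun y _ => this y]
    exact (Group.mulLeft_bijective x).prod_comp (fun y => a y (φ^[i] v))

theorem FPF.exists_sylow {p : ℕ} (hp : p.Prime) {G : Type*} [Group G] [Finite G] {φ : G →* G}
    (h : FPF p φ) (s : ℕ) [hs : Fact s.Prime] :
    ∃ S : Sylow s G, ∀ x ∈ S, φ x ∈ S := by
  let S0 : Sylow s G := default
  have hsurj : Function.Surjective φ := Finite.injective_iff_surjective.1 (h.inj hp)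
  obtain ⟨g, hg⟩ := MulAction.exists_smul_eq G S0 (S0.mapSurjective hsurj)
  obtain ⟨a, ha⟩ := h.surj_div g⁻¹
  have hmem : ∀ (b x : G) (T : Sylow s G), x ∈ b • T ↔ b⁻¹ * x * b ∈ T := by
    intro b x T
    have : x ∈ ((b • T : Sylow s G) : Subgroup G) ↔ b⁻¹ * x * b ∈ (T : Subgroup G) := by
      rw [Sylow.coe_subgroup_smul, Subgroup.mem_pointwise_smul_iff_inv_smul_mem]
      simp [MulAut.smul_def]
    exact this
  refine ⟨a⁻¹ • S0, fun x hx => ?_⟩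
  rw [hmem] at hx ⊢
  have h1 : φ (a⁻¹⁻¹ * x * a⁻¹) ∈ g • S0 := by
    rw [hg]
    exact ⟨_, hx, rfl⟩
  rw [hmem] at h1
  have h2 : φ a = g * a := by
    have := congrArg (fun t => t⁻¹ * a) ha
    simpa using this
  simp only [map_mul, map_inv, h2] at h1
  convert h1 using 1
  group
end Th

namespace Th
open Subgroup

theorem char_inv {G : Type*} [Group G] [Finite G] {φ : G →* G} (hφ : Function.Injective φ)
    {P : Subgroup G} (hP : ∀ x ∈ P, φ x ∈ P) {W : Subgroup P} (hW : W.Characteristic) :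
    ∀ x ∈ W.map P.subtype, φ x ∈ W.map P.subtype := by
  have hinj : Function.Injective (res φ P hP) := by
    intro x y hxy
    exact Subtype.ext (hφ (congrArg Subtype.val hxy))
  let e : P ≃* P := MulEquiv.ofBijective (res φ P hP) (Finite.injective_iff_bijective.1 hinj)
  rintro _ ⟨x, hx, rfl⟩
  exact ⟨e x, characteristic_iff_map_le.1 hW e ⟨x, hx, rfl⟩, rfl⟩

theorem normalizer_inv {G : Type*} [Group G] [Finite G] {φ : G →* G} (hφ : Function.Injective φ)
    {W : Subgroup G} (hW : ∀ x ∈ W, φ x ∈ W) :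
    ∀ x ∈ normalizer (W : Set G), φ x ∈ normalizer (W : Set G) := by
  intro x hx
  have hinj : Function.Injective (res φ W hW) := by
    intro x y hxy
    exact Subtype.ext (hφ (congrArg Subtype.val hxy))
  have hs := Finite.injective_iff_surjective.1 hinj
  apply mem_normalizer_of_conj
  intro u hu
  obtain ⟨w, hw⟩ := hs ⟨u, hu⟩
  have hw' : φ w = u := congrArg Subtype.val hw
  rw [← hw', ← map_inv, ← map_mul, ← map_mul]
  exact hW _ ((mem_normalizer_iff.1 hx _).1 w.2)

theorem card_quot_lt {G : Type*} [Group G] [Finite G] {O : Subgroup G} (hO : O ≠ ⊥) :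
    Nat.card (G ⧸ O) < Nat.card G := by
  have h1 := O.card_eq_card_quotient_mul_card_subgroup
  have h2 : 1 < Nat.card O := (one_lt_card_iff_ne_bot O).2 hO
  have h3 : 0 < Nat.card (G ⧸ O) := Nat.card_pos
  have h4 : Nat.card (G ⧸ O) * 2 ≤ Nat.card G := by
    rw [h1]; exact Nat.mul_le_mul_left _ h2
  omega

/-- a nilpotent group has a proper nontrivial invariant normal subgroup unless nilpotent -/
theorem thompson_X {p : ℕ} (hp : p.Prime) {G : Type*} [Group G] [Finite G] {φ : G →* G}
    (h : FPF p φ)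
    (ih : ∀ L : Subgroup G, L ≠ ⊤ → (∀ x ∈ L, φ x ∈ L) → Group.IsNilpotent L)
    (hn : ¬ Group.IsNilpotent G) :
    ∃ X : Subgroup G, X.Normal ∧ X ≠ ⊥ ∧ X ≠ ⊤ ∧ ∀ x ∈ X, φ x ∈ X := by
  have hpg : ∀ q : ℕ, Fact q.Prime → ¬ IsPGroup q G := fun q _ hq => hn hq.isNilpotent
  have hex : ∃ q, q.Prime ∧ q ≠ 2 ∧ q ∣ Nat.card G := by
    by_contra hno
    push Not at hno
    have : Fact (Nat.Prime 2) := ⟨Nat.prime_two⟩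
    apply hpg 2 this
    apply IsPGroup.of_card (n := (Nat.card G).primeFactorsList.length)
    apply Nat.eq_prime_pow_of_unique_prime_dvd Nat.card_pos.ne'
    intro d hd hdc
    by_contra h2
    exact hno d hd h2 hdc
  obtain ⟨q, hq, hq2, hqd⟩ := hex
  have : Fact q.Prime := ⟨hq⟩
  obtain ⟨P, hP⟩ := h.exists_sylow hp q
  by_cases hH : Hyp q (P : Subgroup G)
  · obtain ⟨K, hKn, hKc, k, hk⟩ := thompson_odd hq2 _ le_rfl P hH
    refine ⟨K, hKn, ?_, ?_, ?_⟩
    · rintro rfl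
      rw [index_bot] at hk
      exact hpg q this (IsPGroup.of_card hk)
    · rintro rfl
      rw [card_top] at hKc
      have := Nat.eq_one_of_dvd_coprimes hKc hqd dvd_rfl
      exact hq.one_lt.ne' this
    · intro x hx
      rw [mem_compl_iff hKn hKc hk] at hx ⊢
      exact Nat.Coprime.coprime_dvd_left (orderOf_map_dvd φ x) hx
  · unfold Hyp at hH
    push Not at hH
    obtain ⟨W, hW, hWb, hWn⟩ := hH
    have hinv := char_inv (h.inj hp) hP hW
    have htop : normalizer ((W.map (P : Subgroup G).subtype : Subgroup G) : Set G) = ⊤ := by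
      by_contra hne
      exact hWn (QNil.of_nilpotent (ih _ hne (normalizer_inv (h.inj hp) hinv)))
    refine ⟨W.map (P : Subgroup G).subtype, normalizer_eq_top_iff.1 htop, ?_, ?_, hinv⟩
    · intro hb
      exact hWb ((map_eq_bot_iff_of_injective _ (subtype_injective _)).1 hb)
    · intro ht
      have : (P : Subgroup G) = ⊤ := by
        rw [eq_top_iff, ← ht]; exact map_subtype_le W
      apply hpg q ‹_›
      have h1 := P.isPGroup'
      rw [this] at h1
      exact h1.of_equiv topEquiv

theorem thompson {p : ℕ} (hp : p.Prime) : ∀ (n : ℕ) {G : Type*} [Group G] [Finite G] (φ : G →* G),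
    Nat.card G ≤ n → FPF p φ → Group.IsNilpotent G := by
  intro n
  induction n with
  | zero => intro G _ _ φ hn; have := Nat.card_pos (α := G); omega
  | succ n ihn =>
    intro G _ _ φ hc h
    by_contra hn
    have ih : ∀ L : Subgroup G, L ≠ ⊤ → (∀ x ∈ L, φ x ∈ L) → Group.IsNilpotent L := by
      intro L hL hi
      exact ihn (res φ L hi) (by have := card_lt_of_ne_top hL; omega) (h.res L hi)
    have ihq : ∀ (O : Subgroup G) [O.Normal], O ≠ ⊥ → (∀ x ∈ O, φ x ∈ O) →
        Group.IsNilpotent (G ⧸ O) := by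
      intro O _ hO hi
      exact ihn _ (by have := card_quot_lt hO; omega) (h.quot O hi)
    have hinj := h.inj hp
    have hsurj : Function.Surjective φ := Finite.injective_iff_surjective.1 hinj
    have hcen : center G = ⊥ := by
      by_contra hb
      apply hn
      have := ihq (center G) hb (by
        intro x hx
        rw [mem_center_iff] at hx ⊢
        intro g
        obtain ⟨g, rfl⟩ := hsurj g
        rw [← map_mul, hx g, map_mul])
      exact Subgroup.isNilpotent_of_ker_le_center (QuotientGroup.mk' (center G))
        (by rw [QuotientGroup.ker_mk'])
    obtain ⟨X, hXn, hXb, hXt, hXi⟩ := thompson_X hp h ih hn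
    have hXnil := ih X hXt hXi
    have hXnt : Nontrivial X := (nontrivial_iff_ne_bot X).2 hXb
    have hZnt : Nontrivial (center X) :=
      (nontrivial_iff_ne_bot _).2 (Group.IsNilpotent.center_ne_bot _)
    set r := (Nat.card (center X)).minFac with hr
    have hrp : Fact r.Prime := ⟨Nat.minFac_prime (Finite.one_lt_card (α := center X)).ne'⟩
    obtain ⟨z, hz⟩ := exists_prime_orderOf_dvd_card' r (Nat.minFac_dvd (Nat.card (center X)))
    have hVn : (om r X).Normal := om_normal r hXn
    have hVi : ∀ x ∈ om r X, φ x ∈ om r X := by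
      rintro v ⟨h1, h2, h3⟩
      refine ⟨hXi v h1, fun x hx => ?_, by rw [← map_pow, h3, map_one]⟩
      have hi : Function.Injective (res φ X hXi) := by
        intro x y hxy
        exact Subtype.ext (hinj (congrArg Subtype.val hxy))
      have hs := Finite.injective_iff_surjective.1 hi
      obtain ⟨y, hy⟩ := hs ⟨x, hx⟩
      have hy' : φ y = x := congrArg Subtype.val hy
      rw [← hy', ← map_mul, h2 y y.2, map_mul]
    have hVb : om r X ≠ ⊥ := by
      intro hb
      have hm : ((z : X) : G) ∈ om r X := by
        refine ⟨z.1.2, fun x hx => ?_, ?_⟩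
        · exact congrArg Subtype.val (mem_center_iff.1 z.2 ⟨x, hx⟩)
        · have := pow_orderOf_eq_one z
          rw [hz] at this
          exact congrArg (fun t : center X => ((t : X) : G)) this
      rw [hb, mem_bot] at hm
      have : z = 1 := Subtype.ext (Subtype.ext hm)
      rw [this, orderOf_one] at hz
      exact hrp.out.one_lt.ne hz
    have hVr : ∀ v ∈ om r X, v ^ r = 1 := fun v hv => hv.2.2
    have hVab : ∀ v ∈ om r X, ∀ w ∈ om r X, v * w = w * v := fun v hv w hw => hw.2.1 v hv.1
    generalize om r X = V at *
    have hGV := ihq V hVb hVi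
    apply hn
    refine ((Group.isNilpotent_of_finite_tfae (G := G)).out 0 3).2 ?_
    intro s hs S
    obtain ⟨Q, hQ⟩ := h.exists_sylow hp s
    suffices hQn : (Q : Subgroup G).Normal by
      have := Sylow.unique_of_normal Q hQn
      rw [Subsingleton.elim S Q]; exact hQn
    have hYn : (V ⊔ (Q : Subgroup G)).Normal := by
      have h1 : ((Q : Subgroup G).map (QuotientGroup.mk' V)).Normal :=
        ((Group.isNilpotent_of_finite_tfae (G := G ⧸ V)).out 0 3 rfl rfl).1 hGV s hs
          (Q.mapSurjective (QuotientGroup.mk'_surjective V))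
      have h2 := h1.comap (QuotientGroup.mk' V)
      rw [comap_map_eq, QuotientGroup.ker_mk', sup_comm] at h2
      exact h2
    have hYi : ∀ x ∈ V ⊔ (Q : Subgroup G), φ x ∈ V ⊔ (Q : Subgroup G) := by
      intro x hx
      obtain ⟨v, hv, y, hy, rfl⟩ := mem_sup_of_normal_left.1 hx
      rw [map_mul]
      exact mul_mem (mem_sup_left (hVi v hv)) (mem_sup_right (hQ y hy))
    have hQY : (Q : Subgroup G) ≤ V ⊔ Q := le_sup_right
    by_cases hY : V ⊔ (Q : Subgroup G) = ⊤
    swap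
    · have hnil := ih _ hY hYi
      have h1 : ((Q.subtype hQY : Sylow s _) : Subgroup (V ⊔ (Q : Subgroup G) : Subgroup G)).Normal :=
        ((Group.isNilpotent_of_finite_tfae).out 0 3 rfl rfl).1 hnil s hs _
      have h2 := Sylow.normalizer_sup_eq_top' Q hQY
      have h3 : V ⊔ (Q : Subgroup G) ≤ normalizer ((Q : Subgroup G) : Set G) := by
        intro y hy
        apply mem_normalizer_of_conj
        intro u hu
        exact h1.conj_mem ⟨u, hQY hu⟩ hu ⟨y, hy⟩
      rw [← normalizer_eq_top_iff, eq_top_iff, ← h2]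
      exact sup_le le_rfl h3
    have hVp : IsPGroup r V := fun v => ⟨1, Subtype.ext (by
      rw [pow_one]; exact hVr v v.2)⟩
    by_cases hsr : s = r
    · rw [← hsr] at hVp
      have h1 : IsPGroup s (V ⊔ (Q : Subgroup G) : Subgroup G) :=
        IsPGroup.to_sup_of_normal_left hVp Q.isPGroup'
      rw [hY] at h1
      exact absurd (h1.of_equiv topEquiv).isNilpotent hn
    exfalso
    apply hVb
    rw [eq_bot_iff]
    intro v hv
    have hcard : (Nat.card Q).Coprime r := by
      obtain ⟨k, hk⟩ := IsPGroup.iff_card.1 Q.isPGroup'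
      rw [hk]
      exact Nat.Coprime.pow_left k ((Nat.coprime_primes hs.out hrp.out).2 hsr)
    have hpow : v ^ Nat.card Q = 1 := by
      letI : CommGroup V := { (inferInstance : Group V) with
        mul_comm := fun a b => Subtype.ext (hVab a a.2 b b.2) }
      have := fpf_key hp (V := V) (Q := (Q : Subgroup G))
        ((MulAut.conjNormal (H := V)).comp (Q : Subgroup G).subtype)
        (φ := res φ V hVi) (ψ := res φ Q hQ) (by
          intro x w
          apply Subtype.ext
          simp [res_coe, MulAut.conjNormal_apply]) (h.res V hVi) (h.res Q hQ) (by
          intro w hw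
          have hwc : (w : G) ∈ center G := by
            rw [mem_center_iff]
            intro g
            have hg : g ∈ V ⊔ (Q : Subgroup G) := by rw [hY]; trivial
            obtain ⟨u, hu, y, hy, rfl⟩ := mem_sup_of_normal_left.1 hg
            have h1 : y * w * y⁻¹ = w := congrArg Subtype.val (hw ⟨y, hy⟩)
            have h2 : y * w = w * y := mul_inv_eq_iff_eq_mul.1 h1
            rw [mul_assoc, h2, ← mul_assoc, hVab u hu w w.2, mul_assoc]
          rw [hcen, mem_bot] at hwc
          exact Subtype.ext hwc) ⟨v, hv⟩
      exact congrArg Subtype.val this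
    rw [mem_bot]
    have := pow_gcd_eq_one.2 ⟨hpow, hVr v hv⟩
    rwa [hcard, pow_one] at this
end Th

namespace Th
open Subgroup

theorem modEq_fixed {p : ℕ} [hp : Fact p.Prime] {α : Type*} [Finite α] (f : α → α)
    (hf : ∀ a, f^[p] a = a) : Nat.card α ≡ Nat.card {a // f a = a} [MOD p] := by
  classical
  have := Fintype.ofFinite α
  let g : Function.End α := f
  have h1 : g ^ p ^ 1 = 1 := by
    rw [pow_one]
    funext a
    have : ∀ i a, (g ^ i) a = f^[i] a := by
      intro i
      induction i with
      | zero => intro a; rfl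
      | succ i ih => intro a; rw [Function.iterate_succ_apply, ← ih, pow_succ]; rfl
    rw [this, hf]; rfl
  have h2 := Equiv.Perm.card_fixedPoints_modEq h1
  rw [Nat.card_eq_fintype_card, Nat.card_eq_fintype_card]
  exact h2

theorem fixed_of_inv {p : ℕ} (hp : p.Prime) {N : Type*} [Group N] [Finite N] {φ : N →* N}
    (hφ : ∀ x, φ^[p] x = x) {M : Subgroup N} (hMi : ∀ x ∈ M, φ x ∈ M)
    (hM : ∀ x, x⁻¹ * φ x ∈ M → x ∈ M) (T : Subgroup N) (hMT : M ≤ T) (hTi : ∀ x ∈ T, φ x ∈ T)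
    (x : N) (hx : x⁻¹ * φ x ∈ T) : x ∈ T := by
  have : Fact p.Prime := ⟨hp⟩
  let f : N ⧸ M → N ⧸ M := Quotient.map' φ (by
    intro a b hab
    rw [QuotientGroup.leftRel_apply] at hab ⊢
    rw [← map_inv, ← map_mul]; exact hMi _ hab)
  have hf : ∀ a : N, f (a : N ⧸ M) = ((φ a : N) : N ⧸ M) := fun a => rfl
  have hfi : ∀ i (a : N), f^[i] (a : N ⧸ M) = ((φ^[i] a : N) : N ⧸ M) := by
    intro i
    induction i with
    | zero => intro a; rfl
    | succ i ih => intro a; rw [Function.iterate_succ_apply, hf, ih, Function.iterate_succ_apply]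
  have hfp : ∀ c : N ⧸ M, f^[p] c = c := by
    intro c
    induction c using QuotientGroup.induction_on with
    | H a => rw [hfi, hφ]
  have hfix : ∀ a : N, f (a : N ⧸ M) = a → a ∈ M := by
    intro a ha
    rw [hf] at ha
    exact hM a (QuotientGroup.eq.1 ha.symm)
  let A : N → Set (N ⧸ M) := fun y => {c | ∃ t ∈ T, c = ((y * t : N) : N ⧸ M)}
  have key : ∀ y, y⁻¹ * φ y ∈ T → Nat.card (A y) ≡ Nat.card {a : A y // f a.1 = a.1} [MOD p] := by
    intro y hy
    have hmaps : Set.MapsTo f (A y) (A y) := by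
      rintro _ ⟨t, ht, rfl⟩
      refine ⟨(y⁻¹ * φ y) * φ t, T.mul_mem hy (hTi t ht), ?_⟩
      rw [hf, map_mul]; congr 1; group
    have := modEq_fixed (p := p) (hmaps.restrict f (A y) (A y)) (by
      intro a
      apply Subtype.ext
      rw [hmaps.iterate_restrict]
      exact hfp a)
    refine this.trans ?_
    have e : Nat.card {a : A y // hmaps.restrict f (A y) (A y) a = a} =
        Nat.card {a : A y // f a.1 = a.1} :=
      Nat.card_congr (Equiv.subtypeEquivRight fun a => Subtype.ext_iff)
    rw [e]
  have hcard : Nat.card (A x) = Nat.card (A 1) := by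
    have : A x = (fun c : N ⧸ M => x • c) '' A 1 := by
      ext c
      constructor
      · rintro ⟨t, ht, rfl⟩
        exact ⟨_, ⟨t, ht, rfl⟩, by simp⟩
      · rintro ⟨_, ⟨t, ht, rfl⟩, rfl⟩
        exact ⟨t, ht, by simp⟩
    rw [this]
    exact Nat.card_image_of_injective (MulAction.injective x) _
  have h1 : Nat.card {a : A 1 // f a.1 = a.1} = 1 := by
    rw [Nat.card_eq_one_iff_unique]
    refine ⟨⟨?_⟩, ⟨⟨⟨_, 1, T.one_mem, rfl⟩, ?_⟩⟩⟩
    · rintro ⟨⟨_, t, ht, rfl⟩, h⟩ ⟨⟨_, u, hu, rfl⟩, h'⟩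
      apply Subtype.ext
      apply Subtype.ext
      have h2 := hfix _ h
      have h3 := hfix _ h'
      exact QuotientGroup.eq.2 (M.mul_mem (M.inv_mem h2) h3)
    · change f _ = _
      rw [hf]
      change ((φ (1 * 1) : N) : N ⧸ M) = ((1 * 1 : N) : N ⧸ M)
      rw [one_mul, map_one]
  have h2 := key 1 (by simp)
  have h3 := key x hx
  rw [h1] at h2
  rw [hcard] at h3
  have h4 := h3.symm.trans h2
  have h5 : Nat.card {a : A x // f a.1 = a.1} ≠ 0 := by
    intro h0
    rw [h0] at h4
    have := (Nat.modEq_iff_dvd' (Nat.zero_le 1)).1 h4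
    exact hp.one_lt.ne' (Nat.dvd_one.1 this)
  have h6 := (Nat.card_ne_zero.1 h5).1
  obtain ⟨⟨_, t, ht, rfl⟩, h7⟩ := h6
  have h8 := hMT (hfix _ h7)
  exact (T.mul_mem_cancel_right ht).1 h8

/-- normality step -/
def NR {N : Type*} [Group N] (A B : Subgroup N) : Prop :=
  A ≤ B ∧ ∀ x ∈ B, ∀ m ∈ A, x * m * x⁻¹ ∈ A

abbrev Sn {N : Type*} [Group N] (A B : Subgroup N) : Prop := Relation.ReflTransGen NR A B

theorem Sn.le {N : Type*} [Group N] {A B : Subgroup N} (h : Sn A B) : A ≤ B := by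
  induction h with
  | refl => exact le_rfl
  | tail _ h ih => exact ih.trans h.1

theorem Sn.inf {N : Type*} [Group N] {A B : Subgroup N} (h : Sn A B) (E : Subgroup N) :
    Sn (A ⊓ E) (B ⊓ E) := by
  induction h with
  | refl => exact .refl
  | tail _ h ih =>
    refine ih.tail ⟨inf_le_inf_right _ h.1, fun x hx m hm => ⟨h.2 x hx.1 m hm.1, ?_⟩⟩
    exact E.mul_mem (E.mul_mem hx.2 hm.2) (E.inv_mem hx.2)

theorem Sn.chain {N : Type*} [Group N] {A B : Subgroup N} (h : Sn A B) :
    ∃ (r : ℕ) (c : ℕ → Subgroup N), c 0 = A ∧ c r = B ∧ ∀ i < r, NR (c i) (c (i + 1)) := by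
  induction h with
  | refl => exact ⟨0, fun _ => A, rfl, rfl, by simp⟩
  | @tail B C _ h ih =>
    obtain ⟨r, c, h0, hr, hc⟩ := ih
    refine ⟨r + 1, fun i => if i ≤ r then c i else C, by simpa using h0, by simp, ?_⟩
    intro i hi
    rcases Nat.lt_succ_iff_lt_or_eq.1 hi with hi | rfl
    · simp only [hi.le, Nat.succ_le_of_lt hi, if_true]
      exact hc i hi
    · simpa [hr] using h

theorem lemmaA.{u} {p : ℕ} {N : Type u} [Group N] [Finite N] {φ : N →* N}
    (hφ : ∀ x, φ^[p] x = x) {E F : Subgroup N} (hEF : NR E F) (hEi : ∀ x ∈ E, φ x ∈ E)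
    (hFi : ∀ x ∈ F, φ x ∈ F) (hE : ∀ x, x⁻¹ * φ x ∈ E → x ∈ E) :
    ∃ (Q : Type u) (_ : Group Q) (_ : Finite Q) (ψ : Q →* Q) (f : F →* Q), FPF p ψ ∧
      Function.Surjective f ∧ (∀ x, f (res φ F hFi x) = ψ (f x)) ∧ ∀ x : F, f x = 1 ↔ (x : N) ∈ E := by
  have hn : (E.subgroupOf F).Normal := ⟨fun m hm x => hEF.2 x x.2 m hm⟩
  have hi : ∀ x ∈ E.subgroupOf F, res φ F hFi x ∈ E.subgroupOf F := fun x hx => hEi x hx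
  refine ⟨F ⧸ E.subgroupOf F, inferInstance, inferInstance,
    QuotientGroup.map _ _ (res φ F hFi) hi, QuotientGroup.mk' _, ⟨?_, ?_⟩,
    QuotientGroup.mk'_surjective _, fun x => rfl, fun x => QuotientGroup.eq_one_iff x⟩
  · intro x
    induction x using QuotientGroup.induction_on with
    | H x =>
      have : ∀ i, (QuotientGroup.map _ _ (res φ F hFi) hi)^[i] (x : F ⧸ E.subgroupOf F) =
          (((res φ F hFi)^[i] x : F) : F ⧸ E.subgroupOf F) := by
        intro i
        induction i with
        | zero => rfl
        | succ i ih =>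
          rw [Function.iterate_succ_apply', Function.iterate_succ_apply', ih]; rfl
      rw [this]
      congr 1
      exact Subtype.ext (by rw [res_iter, hφ])
  · intro x
    induction x using QuotientGroup.induction_on with
    | H x =>
      intro hx
      replace hx : ((res φ F hFi x : F) : F ⧸ E.subgroupOf F) = x := hx
      have := QuotientGroup.eq.1 hx.symm
      rw [QuotientGroup.eq_one_iff]
      exact hE x this

theorem lemmaA_two {p : ℕ} (hp : p.Prime) (hp2 : p = 2) {N : Type*} [Group N] [Finite N]
    {φ : N →* N}
    (hφ : ∀ x, φ^[p] x = x) {E F : Subgroup N} (hEF : NR E F) (hEi : ∀ x ∈ E, φ x ∈ E)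
    (hFi : ∀ x ∈ F, φ x ∈ F) (hE : ∀ x, x⁻¹ * φ x ∈ E → x ∈ E)
    (T : Subgroup N) (hET : E ≤ T) (hTF : T ≤ F) : ∀ x ∈ T, φ x ∈ T := by
  obtain ⟨Q, _, _, ψ, f, hψ, hf, hc, hk⟩ := lemmaA hφ hEF hEi hFi hE
  intro x hx
  have h1 : f (res φ F hFi ⟨x, hTF hx⟩ * ⟨x, hTF hx⟩) = 1 := by
    rw [map_mul, hc]
    generalize f ⟨x, hTF hx⟩ = g
    obtain ⟨a, rfl⟩ := hψ.surj_div g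
    have h2 : ψ (ψ a) = a := by
      have := hψ.per a
      rw [hp2] at this
      exact this
    rw [map_mul, map_inv, h2]; group
  rw [hk] at h1
  exact (T.mul_mem_cancel_right hx).1 (hET h1)

theorem lemmaA_sn {p : ℕ} (hp : p.Prime) {N : Type*} [Group N] [Finite N] {φ : N →* N}
    (hφ : ∀ x, φ^[p] x = x) {E F : Subgroup N} (hEF : NR E F) (hEi : ∀ x ∈ E, φ x ∈ E)
    (hFi : ∀ x ∈ F, φ x ∈ F) (hE : ∀ x, x⁻¹ * φ x ∈ E → x ∈ E) :
    ∀ (n : ℕ) (T : Subgroup N), E ≤ T → T ≤ F → Nat.card F ≤ n + Nat.card T → Sn T F := by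
  obtain ⟨Q, _, _, ψ, f, hψ, hf, hc, hk⟩ := lemmaA hφ hEF hEi hFi hE
  have hnil := thompson hp _ ψ le_rfl hψ
  intro n
  induction n with
  | zero =>
    intro T hET hTF hc
    rw [eq_of_le_of_card_ge hTF (by simpa using hc)]
  | succ n ih =>
    intro T hET hTF hcard
    by_cases hT : T = F
    · rw [hT]
    set T1 := F ⊓ normalizer (T : Set N) with hT1
    have hmem : ∀ x : F, f x ∈ (T.subgroupOf F).map f → (x : N) ∈ T := by
      rintro x ⟨t, ht, htx⟩
      have h1 : f (t⁻¹ * x) = 1 := by rw [map_mul, map_inv, htx, inv_mul_cancel]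
      rw [hk] at h1
      have ht' : (t : N) ∈ T := ht
      have := T.mul_mem ht' (hET h1)
      simpa using this
    have hlt : (T.subgroupOf F).map f < ⊤ := by
      rw [lt_top_iff_ne_top]
      intro htop
      apply hT
      apply le_antisymm hTF
      intro x hx
      exact hmem ⟨x, hx⟩ (by rw [htop]; trivial)
    have hnc := Group.normalizerCondition_of_isNilpotent _ hlt
    obtain ⟨y, hy, hyT⟩ := SetLike.exists_of_lt hnc
    obtain ⟨x, rfl⟩ := hf y
    have hTT1 : T ≤ T1 := le_inf hTF le_normalizer
    have hxT1 : (x : N) ∈ T1 := by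
      refine ⟨x.2, mem_normalizer_of_conj fun t ht => ?_⟩
      have h2 := (mem_normalizer_iff.1 hy (f ⟨t, hTF ht⟩)).1 ⟨⟨t, hTF ht⟩, ht, rfl⟩
      rw [← map_inv, ← map_mul, ← map_mul] at h2
      exact hmem _ h2
    have hxT : (x : N) ∉ T := fun h => hyT ⟨x, h, rfl⟩
    have hcl : Nat.card T < Nat.card T1 := by
      by_contra hle
      have := eq_of_le_of_card_ge hTT1 (not_lt.1 hle)
      rw [← this] at hxT1
      exact hxT hxT1
    refine Relation.ReflTransGen.head ⟨hTT1, fun x hx m hm => ?_⟩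
      (ih T1 (hET.trans hTT1) inf_le_left (by omega))
    exact (mem_normalizer_iff.1 hx.2 m).1 hm
end Th

namespace Th
open Subgroup

theorem sup_inv {N : Type*} [Group N] {φ : N →* N} {A B : Subgroup N} (hA : ∀ x ∈ A, φ x ∈ A)
    (hB : ∀ x ∈ B, φ x ∈ B) : ∀ x ∈ A ⊔ B, φ x ∈ A ⊔ B := by
  have : A ⊔ B ≤ (A ⊔ B).comap φ :=
    sup_le (fun x hx => mem_sup_left (hA x hx)) (fun x hx => mem_sup_right (hB x hx))
  exact this

theorem main_sub {p : ℕ} (hp : p.Prime) {N : Type*} [Group N] [Finite N] {φ : N →* N}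
    (hφ : ∀ x, φ^[p] x = x) {M : Subgroup N}
    (hfix : ∀ T : Subgroup N, M ≤ T → (∀ x ∈ T, φ x ∈ T) → ∀ x, x⁻¹ * φ x ∈ T → x ∈ T)
    (R D : Subgroup N) (hR : p ≠ 2 → ∀ x ∈ R, φ x ∈ R) (hMD : M ≤ D) (hDi : ∀ x ∈ D, φ x ∈ D) :
    ∀ (n : ℕ) (Y : Subgroup N), Nat.card Y ≤ n → (∀ x ∈ Y, φ x ∈ Y) →
      (∀ x ∈ R, ∀ y ∈ Y, x * y * x⁻¹ ∈ Y) → R ⊓ Y = D → Sn D Y →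
      (∀ x ∈ R ⊔ Y, φ x ∈ R ⊔ Y) → Sn R (R ⊔ Y) ∧ ∀ x ∈ R, φ x ∈ R := by
  intro n
  induction n with
  | zero =>
    intro Y hn
    have := Nat.card_pos (α := Y); omega
  | succ n ih =>
    intro Y hcard hYi hRY hD hDY hsup
    have hDR : D ≤ R := hD ▸ inf_le_left
    have hDY' : D ≤ Y := hD ▸ inf_le_right
    by_cases hYD : D = Y
    · have : R ⊔ Y = R := by rw [← hYD]; exact sup_eq_left.2 hDR
      rw [this] at hsup ⊢
      exact ⟨.refl, hsup⟩
    have hB : ∃ B, D ≤ B ∧ NR B Y ∧ B ≠ Y := by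
      clear * - hDY hYD
      induction hDY with
      | refl => exact absurd rfl hYD
      | @tail B C hDB hBC ih =>
        by_cases hBC' : B = C
        · subst hBC'
          exact ih hYD
        · exact ⟨B, Sn.le hDB, hBC, hBC'⟩
    obtain ⟨B, hDB, hBY, hBne⟩ := hB
    set S : Set N := {z | ∃ y ∈ Y, ∃ d ∈ D, z = y * d * y⁻¹} with hS
    set E := closure S with hE
    have hDE : D ≤ E := fun d hd => subset_closure ⟨1, Y.one_mem, d, hd, by simp⟩
    have hEB : E ≤ B := by
      rw [hE, closure_le]
      rintro _ ⟨y, hy, d, hd, rfl⟩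
      exact hBY.2 y hy d (hDB hd)
    have hEY : E ≤ Y := hEB.trans hBY.1
    have hEne : E ≠ Y := fun h => hBne (le_antisymm hBY.1 (h ▸ hEB))
    have hconj : ∀ g : N, (∀ z ∈ S, g * z * g⁻¹ ∈ S) → ∀ z ∈ E, g * z * g⁻¹ ∈ E := by
      intro g hg
      have : E ≤ E.comap (MulAut.conj g).toMonoidHom := by
        conv_lhs => rw [hE]
        rw [closure_le]
        intro z hz
        exact subset_closure (hg z hz)
      exact this
    have hYE : ∀ y ∈ Y, ∀ z ∈ E, y * z * y⁻¹ ∈ E := by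
      intro g hg
      apply hconj
      rintro _ ⟨y, hy, d, hd, rfl⟩
      exact ⟨g * y, Y.mul_mem hg hy, d, hd, by group⟩
    have hRE : ∀ y ∈ R, ∀ z ∈ E, y * z * y⁻¹ ∈ E := by
      intro g hg
      apply hconj
      rintro _ ⟨y, hy, d, hd, rfl⟩
      refine ⟨g * y * g⁻¹, hRY g hg y hy, g * d * g⁻¹, ?_, by group⟩
      rw [← hD]
      exact ⟨R.mul_mem (R.mul_mem hg (hDR hd)) (R.inv_mem hg), hRY g hg d (hDY' hd)⟩
    have hEi : ∀ x ∈ E, φ x ∈ E := by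
      have : E ≤ E.comap φ := by
        conv_lhs => rw [hE]
        rw [closure_le]
        rintro _ ⟨y, hy, d, hd, rfl⟩
        refine subset_closure ⟨φ y, hYi y hy, φ d, hDi d hd, ?_⟩
        rw [map_mul, map_mul, map_inv]
      exact this
    have hSnE : Sn D E := by
      have := Sn.inf hDY E
      rwa [inf_eq_left.2 hDE, inf_eq_right.2 hEY] at this
    have hNR : NR E (R ⊔ Y) := by
      refine ⟨hEY.trans le_sup_right, fun x hx m hm => ?_⟩
      have : R ⊔ Y ≤ normalizer (E : Set N) :=
        sup_le (fun g hg => mem_normalizer_of_conj (hRE g hg))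
          (fun g hg => mem_normalizer_of_conj (hYE g hg))
      exact (mem_normalizer_iff.1 (this hx) m).1 hm
    have hEf := hfix E (hMD.trans hDE) hEi
    have hle : R ⊔ E ≤ R ⊔ Y := sup_le_sup_left hEY R
    have h1 := lemmaA_sn hp hφ hNR hEi hsup hEf _ (R ⊔ E) le_sup_right hle (Nat.le_add_right _ _)
    have h2 : ∀ x ∈ R ⊔ E, φ x ∈ R ⊔ E := by
      by_cases hp2 : p = 2
      · exact lemmaA_two hp hp2 hφ hNR hEi hsup hEf (R ⊔ E) le_sup_right hle
      · exact sup_inv (hR hp2) hEi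
    have hRED : R ⊓ E = D :=
      le_antisymm ((inf_le_inf_left R hEY).trans hD.le) (le_inf hDR hDE)
    have hcl : Nat.card E < Nat.card Y := by
      by_contra hge
      exact hEne (eq_of_le_of_card_ge hEY (not_lt.1 hge))
    obtain ⟨h3, h4⟩ := ih E (by omega) hEi hRE hRED hSnE h2
    exact ⟨h3.trans h1, h4⟩

theorem main_thm {p : ℕ} (hp : p.Prime) {N : Type*} [Group N] [Finite N] {φ : N →* N}
    (hφ : ∀ x, φ^[p] x = x) {M : Subgroup N}
    (hfix : ∀ T : Subgroup N, M ≤ T → (∀ x ∈ T, φ x ∈ T) → ∀ x, x⁻¹ * φ x ∈ T → x ∈ T)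
    (r : ℕ) (c : ℕ → Subgroup N) (h0 : c 0 = M) (hc : ∀ i < r, NR (c i) (c (i + 1)))
    (hi : ∀ i ≤ r, ∀ x ∈ c i, φ x ∈ c i) :
    ∀ i ≤ r, M ≤ c i ∧ ∀ R : Subgroup N, M ≤ R → R ≤ c i → (p ≠ 2 → ∀ x ∈ R, φ x ∈ R) →
      Sn R (c i) ∧ ∀ x ∈ R, φ x ∈ R := by
  intro i
  induction i with
  | zero =>
    intro h
    refine ⟨h0.ge, fun R h1 h2 _ => ?_⟩
    have : R = c 0 := le_antisymm h2 (h0 ▸ h1)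
    rw [this]
    exact ⟨.refl, hi 0 h⟩
  | succ i ih =>
    intro hir
    obtain ⟨hMi, ih⟩ := ih (by omega)
    have hN := hc i (by omega)
    have hCi := hi i (by omega)
    have hFi := hi (i + 1) hir
    refine ⟨hMi.trans hN.1, fun R hMR hR hRi => ?_⟩
    obtain ⟨h1, h2⟩ := ih (R ⊓ c i) (le_inf hMR hMi) inf_le_right
      (fun h x hx => ⟨hRi h x hx.1, hCi x hx.2⟩)
    have hCf := hfix (c i) hMi hCi
    have hle : R ⊔ c i ≤ c (i + 1) := sup_le hR hN.1
    have h3 := lemmaA_sn hp hφ hN hCi hFi hCf _ (R ⊔ c i) le_sup_right hle (Nat.le_add_right _ _)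
    have h4 : ∀ x ∈ R ⊔ c i, φ x ∈ R ⊔ c i := by
      by_cases hp2 : p = 2
      · exact lemmaA_two hp hp2 hφ hN hCi hFi hCf (R ⊔ c i) le_sup_right hle
      · exact sup_inv (hRi hp2) hCi
    obtain ⟨h5, h6⟩ := main_sub hp hφ hfix R (R ⊓ c i) hRi (le_inf hMR hMi) h2 _ (c i) le_rfl hCi
      (fun x hx y hy => hN.2 x (hR hx) y hy) rfl h1 h4
    exact ⟨h5.trans h3, h6⟩

end Th
/-- Let `σ` be an automorphism of prime order `p` of a finite group `N`, and `M`
a `σ`-invariant subnormal subgroup such that `σ` acts fixed-point-freely on the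
factors of some `σ`-invariant subnormal series from `M` to `N`. If `M ≤ R ≤ N`
and `R` is `σ`-invariant in case `p > 2`, then `R` is subnormal in `N` and `R` is
`σ`-invariant even when `p = 2`. -/
theorem stmt16 (N : Type*) [Group N] [Finite N] (p : ℕ) (hp : p.Prime)
    (σ : MulAut N) (hord : orderOf σ = p) (M : Subgroup N)
    (hM : Subgroup.map σ.toMonoidHom M = M)
    (hser : ∃ (r : ℕ) (c : ℕ → Subgroup N),
      c 0 = M ∧ c r = ⊤ ∧ IsNormalChain c r ∧
      (∀ i ≤ r, Subgroup.map σ.toMonoidHom (c i) = c i) ∧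
      (∀ i < r, ∀ x ∈ c (i + 1), σ x * x⁻¹ ∈ c i → x ∈ c i))
    (R : Subgroup N) (hMR : M ≤ R)
    (hRinv : 2 < p → Subgroup.map σ.toMonoidHom R = R) :
    (∃ (r : ℕ) (c : ℕ → Subgroup N), c 0 = R ∧ c r = ⊤ ∧ IsNormalChain c r) ∧
      Subgroup.map σ.toMonoidHom R = R := by
  obtain ⟨r, c, h0, hr, hc, hi, hf⟩ := hser
  have hinv : ∀ T : Subgroup N, Subgroup.map σ.toMonoidHom T = T →
      ∀ x ∈ T, σ.toMonoidHom x ∈ T := by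
    intro T hT x hx
    have := Subgroup.mem_map_of_mem σ.toMonoidHom hx
    rwa [hT] at this
  have hφ : ∀ x, σ.toMonoidHom^[p] x = x := by
    intro x
    have h1 : ∀ i, σ.toMonoidHom^[i] x = (σ ^ i) x := by
      intro i
      induction i with
      | zero => rfl
      | succ i ih => rw [Function.iterate_succ_apply', ih, pow_succ']; rfl
    rw [h1, ← hord, pow_orderOf_eq_one]; rfl
  have hmono : ∀ i ≤ r, M ≤ c i := by
    intro i
    induction i with
    | zero => intro _; exact h0.ge
    | succ i ih => intro h; exact (ih (by omega)).trans (hc i (by omega)).1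
  have hMf : ∀ x, σ x * x⁻¹ ∈ M → x ∈ M := by
    intro x hx
    have : ∀ j ≤ r, x ∈ c (r - j) := by
      intro j
      induction j with
      | zero => intro _; rw [Nat.sub_zero, hr]; trivial
      | succ j ih =>
        intro hj
        have h1 := ih (by omega)
        rw [show r - j = (r - (j + 1)) + 1 by omega] at h1
        exact hf _ (by omega) x h1 (hmono _ (by omega) hx)
    have h1 := this r le_rfl
    rwa [Nat.sub_self, h0] at h1
  have hMf' : ∀ x, x⁻¹ * σ.toMonoidHom x ∈ M → x ∈ M := by
    intro x hx
    have h1 : σ x⁻¹ * x⁻¹⁻¹ ∈ M := by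
      have h2 := M.inv_mem hx
      rw [mul_inv_rev, inv_inv] at h2
      rw [map_inv, inv_inv]
      exact h2
    exact inv_mem_iff.1 (hMf _ h1)
  have hfix := fun T hMT hT => Th.fixed_of_inv hp hφ (hinv M hM) hMf' T hMT hT
  have key := (Th.main_thm hp hφ hfix r c h0 hc (fun i hir => hinv _ (hi i hir)) r le_rfl).2 R hMR
    (by rw [hr]; exact le_top)
    (fun h2 => hinv R (hRinv (lt_of_le_of_ne hp.two_le (Ne.symm h2))))
  rw [hr] at key
  obtain ⟨h1, h2⟩ := key
  refine ⟨Th.Sn.chain h1, ?_⟩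
  apply Subgroup.eq_of_le_of_card_ge
  · rintro _ ⟨x, hx, rfl⟩
    exact h2 x hx
  · exact (Subgroup.card_map_of_injective (f := σ.toMonoidHom) σ.injective).ge
end

section
/- Let V be a finite group and U ⊆ V a subgroup with |V:U| a power of a prime p. Let X be a simple module for V over a field F of characteristic p, and suppose that, regarded as an F[U]-module, all composition factors of X are isomorphic to each other and one-dimensional over F. Then X itself is one-dimensional over F. -/
/-- elements acting on a subset by a common nonzero scalar -/
def scalarSub (V F X : Type*) [Group V] [Field F] [AddCommGroup X] [Module F X]
    [DistribMulAction V X] [SMulCommClass V F X] (A : Set X) : Subgroup V where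
  carrier := {g | ∃ c : F, c ≠ 0 ∧ ∀ x ∈ A, g • x = c • x}
  one_mem' := ⟨1, one_ne_zero, fun x _ => by simp⟩
  mul_mem' := by
    rintro a b ⟨c, hc, h⟩ ⟨d, hd, h'⟩
    refine ⟨c * d, mul_ne_zero hc hd, fun x hx => ?_⟩
    rw [mul_smul, h' x hx, smul_comm, h x hx, smul_smul, mul_comm]
  inv_mem' := by
    rintro a ⟨c, hc, h⟩
    refine ⟨c⁻¹, inv_ne_zero hc, fun x hx => ?_⟩
    rw [inv_smul_eq_iff, smul_comm, h x hx, smul_smul, inv_mul_cancel₀ hc, one_smul]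

theorem scalarSub_normal (V F X : Type*) [Group V] [Field F] [AddCommGroup X] [Module F X]
    [DistribMulAction V X] [SMulCommClass V F X] :
    (scalarSub V F X Set.univ).Normal where
  conj_mem := by
    rintro a ⟨c, hc, h⟩ g
    refine ⟨c, hc, fun x hx => ?_⟩
    rw [mul_smul, mul_smul, h _ trivial, smul_comm, smul_inv_smul]

theorem exists_fixed_vec (P : Type*) [Group P] [Finite P] (p : ℕ) [Fact p.Prime]
    (hP : IsPGroup p P) (X : Type*) [AddCommGroup X] [Nontrivial X] [DistribMulAction P X]
    [Module (ZMod p) X] (htor : ∀ x : X, p • x = 0) : ∃ x : X, x ≠ 0 ∧ ∀ g : P, g • x = x := by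
  obtain ⟨x, hx⟩ := exists_ne (0 : X)
  let A : Submodule (ZMod p) X := Submodule.span (ZMod p) (Set.range fun g : P => g • x)
  have hAfin : Module.Finite (ZMod p) ↥A :=
    Module.Finite.span_of_finite (ZMod p) (Set.finite_range (fun g : P => g • x))
  have hfin : Finite A := Module.finite_of_finite (ZMod p)
  have hst : ∀ g : P, ∀ y ∈ A, g • y ∈ A := by
    intro g y hy
    induction hy using Submodule.span_induction with
    | mem y hy =>
      obtain ⟨k, rfl⟩ := hy
      exact Submodule.subset_span ⟨g * k, by simp [mul_smul]⟩
    | zero => simp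
    | add a b _ _ ha hb => rw [smul_add]; exact A.add_mem ha hb
    | smul c a _ ha =>
      have : g • c • a = c • g • a :=
        ZMod.map_smul (DistribSMul.toAddMonoidHom X g) c a
      rw [this]; exact A.smul_mem c ha
  let : MulAction P A :=
    { smul := fun g y => ⟨g • y.1, hst g _ y.2⟩
      one_smul := fun y => Subtype.ext (one_smul P y.1)
      mul_smul := fun a b y => Subtype.ext (mul_smul a b y.1) }
  have hxA : x ∈ A := Submodule.subset_span ⟨1, by simp⟩
  have hcard : p ∣ Nat.card A := by
    have : addOrderOf (⟨x, hxA⟩ : A) = p := by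
      apply addOrderOf_eq_prime
      · exact Subtype.ext (htor x)
      · intro h; exact hx (congrArg Subtype.val h)
    exact this.symm.dvd.trans (addOrderOf_dvd_natCard _)
  have h0 : (0 : A) ∈ MulAction.fixedPoints P A := fun g => Subtype.ext (smul_zero g)
  obtain ⟨b, hb, hne⟩ := hP.exists_fixed_point_of_prime_dvd_card_of_fixed_point A hcard h0
  refine ⟨b.1, fun h => hne (Subtype.ext h.symm), fun g => congrArg Subtype.val (hb g)⟩

/-- Let `U ≤ V` have `p`-power index, `F` a field of characteristic `p`, and `X` a
simple `F`-linear `V`-module all of whose `U`-composition factors are isomorphic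
and one-dimensional (i.e. `U` acts on each factor via a common character `lam`).
Then `X` is one-dimensional. -/
theorem stmt17 (V : Type*) [Group V] [Finite V] (U : Subgroup V)
    (p : ℕ) (hp : p.Prime) (hindex : ∃ k : ℕ, U.index = p ^ k)
    (F : Type*) [Field F] [CharP F p]
    (X : Type*) [AddCommGroup X] [Module F X] [Nontrivial X]
    [DistribMulAction V X] [SMulCommClass V F X]
    (hsimple : ∀ W : Submodule F X,
      (∀ g : V, ∀ w ∈ W, g • w ∈ W) → W = ⊥ ∨ W = ⊤)
    (hcomp : ∃ (m : ℕ) (W : ℕ → Submodule F X) (lam : U →* F),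
      W 0 = ⊥ ∧ W m = ⊤ ∧ ∀ i < m,
        W i ≤ W (i + 1) ∧
        (∀ u : U, ∀ w ∈ W i, (u : V) • w ∈ W i) ∧
        (∃ x : X, x ∉ W i ∧ W (i + 1) = W i ⊔ Submodule.span F {x}) ∧
        (∀ u : U, ∀ y ∈ W (i + 1), (u : V) • y - lam u • y ∈ W i)) :
    Module.finrank F X = 1 := by
  have : Fact p.Prime := ⟨hp⟩
  obtain ⟨m, W, lam, hW0, hWm, hW⟩ := hcomp
  obtain ⟨k, hk⟩ := hindex
  let H := scalarSub V F X Set.univ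
  have hHn : H.Normal := scalarSub_normal V F X
  have hpow : ∀ u : U, (u : V) ^ p ^ m ∈ H := by
    intro u
    let f : Module.End F X := DistribSMul.toLinearMap F X (u : V)
    let s : Module.End F X := algebraMap F _ (lam u)
    have hcomm : Commute f s := (Algebra.commutes (lam u) f).symm
    have hnil : ∀ i ≤ m, ∀ y ∈ W i, ((f - s) ^ i) y = 0 := by
      intro i
      induction i with
      | zero => intro _ y hy; rw [hW0] at hy; simpa using hy
      | succ i ih =>
        intro hi y hy
        rw [pow_succ, Module.End.mul_apply]
        exact ih (by omega) _ ((hW i (by omega)).2.2.2 u y hy)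
    have h0 : (f - s) ^ m = 0 := by
      ext y
      exact hnil m le_rfl y (by rw [hWm]; trivial)
    have h1 : (f - s) ^ p ^ m = 0 :=
      pow_eq_zero_of_le (Nat.lt_pow_self hp.one_lt).le h0
    have : CharP (Module.End F X) p := charP_of_injective_algebraMap
      (algebraMap F (Module.End F X)).injective p
    rw [sub_pow_char_pow_of_commute _ _ hcomm, sub_eq_zero] at h1
    refine ⟨lam u ^ p ^ m, pow_ne_zero _ ((Group.isUnit u).map lam).ne_zero, fun x _ => ?_⟩
    have h2 : ∀ n : ℕ, (f ^ n) x = (u : V) ^ n • x := by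
      intro n
      induction n with
      | zero => simp
      | succ n ih =>
        rw [pow_succ', Module.End.mul_apply, ih, pow_succ', mul_smul]; rfl
    rw [← h2, h1, ← map_pow]; rfl
  have hPG : IsPGroup p (U ⧸ H.subgroupOf U) := by
    intro q
    induction q using QuotientGroup.induction_on with
    | H u =>
      refine ⟨m, ?_⟩
      rw [← QuotientGroup.mk_pow, QuotientGroup.eq_one_iff]
      exact hpow u
  obtain ⟨n, hn⟩ := IsPGroup.iff_card.mp hPG
  have hrel : H.relIndex U = p ^ n := hn
  have hHi : H.index ∣ p ^ (n + k) := by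
    have h1 : (H ⊓ U).index = p ^ (n + k) := by
      rw [← Subgroup.relIndex_mul_index (inf_le_right : H ⊓ U ≤ U),
        Subgroup.inf_relIndex_right, hrel, hk, pow_add]
    rw [← h1]; exact Subgroup.index_dvd_of_le inf_le_left
  let P : Sylow p V := default
  have htor : ∀ y : X, p • y = 0 := fun y => by
    rw [← Nat.cast_smul_eq_nsmul F, CharP.cast_eq_zero, zero_smul]
  let hmod : Module (ZMod p) X := AddCommGroup.zmodModule htor
  obtain ⟨x, hx, hfix⟩ := exists_fixed_vec P p P.isPGroup' X htor
  let S := scalarSub V F X {x}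
  have hHS : H ≤ S := by
    rintro g ⟨c, hc, h⟩
    exact ⟨c, hc, fun y _ => h y trivial⟩
  have hPS : (P : Subgroup V) ≤ S := by
    intro g hg
    refine ⟨1, one_ne_zero, ?_⟩
    rintro y rfl
    rw [one_smul]; exact hfix ⟨g, hg⟩
  have hStop : S = ⊤ := by
    rw [← Subgroup.index_eq_one]
    have hnd : ¬ p ∣ S.index := fun h => P.not_dvd_index (h.trans (Subgroup.index_dvd_of_le hPS))
    exact Nat.Coprime.eq_one_of_dvd
      (((Nat.Prime.coprime_iff_not_dvd hp).2 hnd).symm.pow_right _)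
      ((Subgroup.index_dvd_of_le hHS).trans hHi)
  have hspan := hsimple (Submodule.span F {x}) (by
    intro g w hw
    obtain ⟨a, rfl⟩ := Submodule.mem_span_singleton.1 hw
    have hg : g ∈ S := hStop ▸ Subgroup.mem_top g
    obtain ⟨c, _, hc⟩ := hg
    rw [smul_comm, hc x rfl]
    exact Submodule.smul_mem _ _ (Submodule.smul_mem _ _ (Submodule.mem_span_singleton_self x)))
  rcases hspan with h | h
  · exact absurd (Submodule.span_singleton_eq_bot.1 h) hx
  · rw [← finrank_top, ← h]; exact finrank_span_singleton hx
end
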